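/- Suppose the setup of the Gehring lemma with tail with s = 2_* = (2n+4)/(n+4): g, f, h ≥ 0 with g², f², h^{2_*} ∈ L¹(ℝ^{n+1}) and, for some A ≥ 1 and every parabolic cylinder B, (⨍⨍_B g² dμ)^{1/2} ≤ A·a_g(B) + (a_{f²}(B))^{1/2} + r(B)(a_{h^{2_*}}(B))^{1/2_*}. Then for p > 2 with p − 2 small enough depending on A and dimension, ‖g‖_{L^p(ℝ^{n+1})} ≲ ‖f‖_{L^p(ℝ^{n+1})} + ‖h‖_{L^{p_*}(ℝ^{n+1})}, with implicit constant depending on A, p and n, where 1/p_* = 1/p + 1/(n+2). -/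

import Mathlib

open MeasureTheory Real Complex Filter Set Metric
open scoped FourierTransform Topology ENNReal NNReal

noncomputable section

/-- Spatial variable: `ℝⁿ`. -/
abbrev Spc (n : ℕ) := Fin n → ℝ
/-- Space-time point `(t,x) ∈ ℝ^{1+n}`. -/
abbrev Pt (n : ℕ) := ℝ × Spc n
/-- Values `ℂᵐ`. -/
abbrev Val (m : ℕ) := Fin m → ℂ
/-- Gradient-type values `ℂ^{nm}`: index `i` for the spatial direction, `α` for the component. -/
abbrev Grad (n m : ℕ) := Fin n → Fin m → ℂ

variable {n m : ℕ}

/-- Hermitian dot product `v ⋅ conj w` on `ℂ^{nm}`. -/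
def gdot (v w : Grad n m) : ℂ := ∑ i, ∑ α, v i α * (starRingEnd ℂ) (w i α)

/-- Hermitian dot product `v ⋅ conj w` on `ℂᵐ`. -/
def vdot (v w : Val m) : ℂ := ∑ α, v α * (starRingEnd ℂ) (w α)

/-- Euclidean norm on `ℂ^{nm}`. -/
def gnorm (G : Grad n m) : ℝ := Real.sqrt (∑ i, ∑ α, ‖G i α‖ ^ 2)

/-- Euclidean norm on `ℂᵐ`. -/
def vnorm (v : Val m) : ℝ := Real.sqrt (∑ α, ‖v α‖ ^ 2)

/-- Spatial gradient of a (smooth) function on space-time. -/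
def tgrad (φ : Pt n → Val m) (z : Pt n) : Grad n m :=
  fun i α => fderiv ℝ φ z ((0 : ℝ), Pi.single i (1:ℝ)) α

/-- Spatial gradient of a (smooth) function on space. -/
def tgradx (v : Spc n → Val m) (x : Spc n) : Grad n m :=
  fun i α => fderiv ℝ v x (Pi.single i (1:ℝ)) α

/-- Time derivative `∂_t φ` of a smooth function on space-time. -/
def tdt (φ : Pt n → Val m) (z : Pt n) : Val m := fun α => fderiv ℝ φ z ((1:ℝ), (0 : Spc n)) α

/-- Scalar spatial partial derivative `∂_i φ`. -/
def tdx (φ : Pt n → ℂ) (i : Fin n) (z : Pt n) : ℂ := fderiv ℝ φ z ((0:ℝ), Pi.single i (1:ℝ))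

/-- Scalar time derivative `∂_t φ`. -/
def tdtc (φ : Pt n → ℂ) (z : Pt n) : ℂ := fderiv ℝ φ z ((1:ℝ), (0 : Spc n))

/-- Test functions for a space-time domain `Ω`. -/
def IsTest (Ω : Set (Pt n)) (φ : Pt n → Val m) : Prop :=
  ContDiff ℝ (⊤:ℕ∞) φ ∧ HasCompactSupport φ ∧ tsupport φ ⊆ Ω

/-- `Du` is the weak (distributional) spatial gradient of `u` on `Ω`. -/
def IsWeakGrad (Ω : Set (Pt n)) (u : Pt n → Val m) (Du : Pt n → Grad n m) : Prop :=
  ∀ φ : Pt n → ℂ, ContDiff ℝ (⊤:ℕ∞) φ → HasCompactSupport φ → tsupport φ ⊆ Ω →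
    ∀ i α, ∫ z in Ω, u z α * tdx φ i z = - ∫ z in Ω, Du z i α * φ z

/-- Coefficients bounded (in `L^∞`) by `M`. -/
def BddCoeff (A : Pt n → (Grad n m →L[ℂ] Grad n m)) (M : ℝ) : Prop := ∀ z, ‖A z‖ ≤ M

/-- Zero-order coefficients bounded by `M`. -/
def BddCoeff0 (B : Pt n → (Val m →L[ℂ] Val m)) (M : ℝ) : Prop := ∀ z, ‖B z‖ ≤ M

/-- The Gårding inequality for `A`, with constants `lam > 0`, `kap ≥ 0`, uniformly in `t`,
tested on smooth compactly supported functions (dense in `W^{1,2}(ℝⁿ;ℂᵐ)`). -/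
def Garding (A : Pt n → (Grad n m →L[ℂ] Grad n m)) (lam kap : ℝ) : Prop :=
  ∀ t : ℝ, ∀ v : Spc n → Val m, ContDiff ℝ (⊤:ℕ∞) v → HasCompactSupport v →
    lam * (∫ x, gnorm (tgradx v x) ^ 2) - kap * (∫ x, vnorm (v x) ^ 2)
      ≤ (∫ x, gdot (A (t, x) (tgradx v x)) (tgradx v x)).re

/-- `u` (with weak spatial gradient `Du`) is a weak solution of
`∂_t u − div A ∇u = f + div F` on `Ω`. -/
def IsWeakSol (Ω : Set (Pt n)) (A : Pt n → (Grad n m →L[ℂ] Grad n m))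
    (u : Pt n → Val m) (Du : Pt n → Grad n m)
    (f : Pt n → Val m) (F : Pt n → Grad n m) : Prop :=
  IsWeakGrad Ω u Du ∧
  ∀ φ : Pt n → Val m, IsTest Ω φ →
    (∫ z in Ω, gdot (A z (Du z)) (tgrad φ z)) - (∫ z in Ω, vdot (u z) (tdt φ z))
      = (∫ z in Ω, vdot (f z) (φ z)) - (∫ z in Ω, gdot (F z) (tgrad φ z))

/-- Local `L^p` integrability (of a scalar magnitude function) on `Ω`. -/
def MemLocP (Ω : Set (Pt n)) (g : Pt n → ℝ) (p : ℝ) : Prop :=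
  ∀ K : Set (Pt n), IsCompact K → K ⊆ Ω → IntegrableOn (fun z => |g z| ^ p) K

/-- The open interval of length `ℓ` centered at `t₀`. -/
def tIv (t₀ ℓ : ℝ) : Set ℝ := Set.Ioo (t₀ - ℓ/2) (t₀ + ℓ/2)

/-- The open parabolic cylinder `I × Q` with `I` centered at `t₀` of length `ℓ` and
`Q` the ball of radius `r` centered at `x₀`. -/
def cylinder (t₀ : ℝ) (x₀ : Spc n) (ℓ r : ℝ) : Set (Pt n) :=
  tIv t₀ ℓ ×ˢ Metric.ball x₀ r

/-- Lower parabolic Sobolev conjugate: `1/p_* = 1/p + 1/(n+2)`. -/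
def pLow (p : ℝ) (n : ℕ) : ℝ := (p⁻¹ + ((n : ℝ) + 2)⁻¹)⁻¹

/-- Upper parabolic Sobolev conjugate: `1/p* = 1/p − 1/(n+2)`. -/
def pUp (p : ℝ) (n : ℕ) : ℝ := (p⁻¹ - ((n : ℝ) + 2)⁻¹)⁻¹

/-- `D_t^{1/2} φ` for a nice function of one (time) variable, via the Fourier
symbol `|τ|^{1/2}`. -/
def halfDerivTest (φ : ℝ → ℂ) : ℝ → ℂ :=
  𝓕⁻ (fun τ : ℝ => (Real.sqrt |τ| : ℂ) * 𝓕 φ τ)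

/-- `H_t φ` for a nice function of one (time) variable, via the Fourier symbol `i sgn τ`. -/
def hilbertTest (φ : ℝ → ℂ) : ℝ → ℂ :=
  𝓕⁻ (fun τ : ℝ => Complex.I * (Real.sign τ : ℂ) * 𝓕 φ τ)

/-- `D` is the half-order time derivative `D_t^{1/2} v`, in the sense of duality with
test functions in the time variable (the symbol `|τ|^{1/2}` is even, so `D_t^{1/2}` is
symmetric for the bilinear pairing). -/
def IsHalfTimeDeriv (v D : Pt n → Val m) : Prop :=
  ∀ φ : ℝ → ℂ, ContDiff ℝ (⊤:ℕ∞) φ → HasCompactSupport φ → ∀ α : Fin m,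
    ∀ᵐ x : Spc n, ∫ t, D (t, x) α * φ t = ∫ t, v (t, x) α * halfDerivTest φ t

/-- `H` is the Hilbert transform `H_t v` in the time variable, in the sense of duality
(`H_t` is skew-symmetric for the bilinear pairing). -/
def IsHilbertPair (v H : Pt n → Val m) : Prop :=
  ∀ φ : ℝ → ℂ, ContDiff ℝ (⊤:ℕ∞) φ → HasCompactSupport φ → ∀ α : Fin m,
    ∀ᵐ x : Spc n, ∫ t, H (t, x) α * φ t = - ∫ t, v (t, x) α * hilbertTest φ t

/-- `D_t^{1/2} φ` of a smooth compactly supported function on space-time,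
computed slice-wise in the time variable. -/
def halfDerivFun (φ : Pt n → ℂ) : Pt n → ℂ :=
  fun z => 𝓕⁻ (fun τ : ℝ => (Real.sqrt |τ| : ℂ) * 𝓕 (fun s => φ (s, z.2)) τ) z.1

/-- Absolute continuity (on all of `ℝ`) of a real function. -/
def AbsCont (g : ℝ → ℝ) : Prop :=
  ∀ ε > (0:ℝ), ∃ δ > (0:ℝ), ∀ (s : Finset ℕ) (a b : ℕ → ℝ),
    (∀ i ∈ s, a i ≤ b i) →
    ((s : Set ℕ).PairwiseDisjoint fun i => Set.Ioo (a i) (b i)) →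
    (∑ i ∈ s, (b i - a i)) < δ → (∑ i ∈ s, |g (b i) - g (a i)|) < ε

/-- The cut-off `χ • u`. -/
def locU (χ : Pt n → ℂ) (u : Pt n → Val m) : Pt n → Val m := fun z α => χ z * u z α

/-- The gradient of `χ u`: `χ ∇u + u ⊗ ∇χ`. -/
def locGrad (χ : Pt n → ℂ) (u : Pt n → Val m) (Du : Pt n → Grad n m) : Pt n → Grad n m :=
  fun z i α => χ z * Du z i α + u z α * tdx χ i z

/-- The right-hand side `f̃ = χ f + (∂_t χ) u − A ∇u · ∇χ − F · ∇χ` appearing after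
localization. -/
def locf (A : Pt n → (Grad n m →L[ℂ] Grad n m)) (χ : Pt n → ℂ)
    (u : Pt n → Val m) (Du : Pt n → Grad n m)
    (f : Pt n → Val m) (F : Pt n → Grad n m) : Pt n → Val m :=
  fun z α => χ z * f z α + tdtc χ z * u z α
    - (∑ i, A z (Du z) i α * tdx χ i z) - (∑ i, F z i α * tdx χ i z)

/-- The right-hand side `F̃ = −A(u ∇χ) + F χ` appearing after localization. -/
def locF (A : Pt n → (Grad n m →L[ℂ] Grad n m)) (χ : Pt n → ℂ)
    (u : Pt n → Val m) (F : Pt n → Grad n m) : Pt n → Grad n m :=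
  fun z i α => - A z (fun j β => u z β * tdx χ j z) i α + F z i α * χ z

/-- The tail functional `a_u(B) = Σ_j 2^{-j-1} ⨍⨍_{4^j I × γ Q} u`. -/
def tailAvg (γ : ℝ) (u : Pt n → ℝ) (t₀ : ℝ) (x₀ : Spc n) (r : ℝ) : ℝ :=
  ∑' j : ℕ, ((2:ℝ)⁻¹) ^ (j+1) * ⨍ z in cylinder t₀ x₀ ((4:ℝ)^j * r^2) (γ * r), u z

/-- An element of the space `E_p = L^p(ℝ;W^{1,p}) ∩ H^{1/2,p}(ℝ;L^p)`: a function
together with its weak spatial gradient, half-order time derivative, and the Hilbert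
transform in time of the latter, all `p`-integrable. -/
structure EpElem (n m : ℕ) (p : ℝ) where
  u : Pt n → Val m
  Du : Pt n → Grad n m
  Dh : Pt n → Val m
  HDh : Pt n → Val m
  grad : IsWeakGrad Set.univ u Du
  half : IsHalfTimeDeriv u Dh
  hilb : IsHilbertPair Dh HDh
  memu : Integrable (fun z => vnorm (u z) ^ p)
  memDu : Integrable (fun z => gnorm (Du z) ^ p)
  memDh : Integrable (fun z => vnorm (Dh z) ^ p)

/-- The `E_p` norm. -/
def EnormP (p : ℝ) (U : EpElem n m p) : ℝ :=
  ((∫ z, vnorm (U.u z) ^ p) + (∫ z, gnorm (U.Du z) ^ p) + (∫ z, vnorm (U.Dh z) ^ p)) ^ (1/p)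

/-- The sesquilinear form of `𝓛 = ∂_t − div A ∇ + κ + 1` on `E_p × E_q`. -/
def LformP {p q : ℝ} (A : Pt n → (Grad n m →L[ℂ] Grad n m)) (kap : ℝ)
    (U : EpElem n m p) (V : EpElem n m q) : ℂ :=
  ∫ z, gdot (A z (U.Du z)) (V.Du z) + vdot (U.HDh z) (V.Dh z)
    + ((kap + 1 : ℝ) : ℂ) * vdot (U.u z) (V.u z)

/-- The action `⟨𝓛 U, φ⟩` on a smooth compactly supported test function `φ`. -/
def LformTest (A : Pt n → (Grad n m →L[ℂ] Grad n m)) (kap : ℝ)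
    (u : Pt n → Val m) (Du : Pt n → Grad n m) (HDh : Pt n → Val m)
    (φ : Pt n → Val m) : ℂ :=
  ∫ z, gdot (A z (Du z)) (tgrad φ z)
    + vdot (HDh z) (fun α => halfDerivFun (fun w => φ w α) z)
    + ((kap + 1 : ℝ) : ℂ) * vdot (u z) (φ z)


/-- The `L^p(ℝ^{n+1})` norm (valued in `ℝ≥0∞`) of a scalar magnitude function. -/
def pnormE (g : Pt n → ℝ) (p : ℝ) : ℝ≥0∞ := eLpNorm g (ENNReal.ofReal p) volume

/-- The mixed norm `‖H‖_{L^{qa}(ℝ; L^{qb}(ℝⁿ))}`, valued in `ℝ≥0∞`. -/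
def mixedNorm (H : Pt n → ℝ) (qa qb : ℝ) : ℝ≥0∞ :=
  (∫⁻ t : ℝ, ((∫⁻ x : Spc n, ENNReal.ofReal |H (t, x)| ^ qb) ^ (1/qb)) ^ qa) ^ (1/qa)


/-- The `ℝ≥0∞`-valued `L^p` average `(⨍⨍_S |g|^p)^{1/p}` over a set of space-time. -/
def avgP (S : Set (Pt n)) (g : Pt n → ℝ) (p : ℝ) : ℝ≥0∞ :=
  (⨍⁻ z in S, ENNReal.ofReal (|g z| ^ p) ∂volume) ^ (1/p)

/-- The `ℝ≥0∞`-valued `L^p` average `(⨍_S |g|^p)^{1/p}` over a set of space. -/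
def avgPx {n : ℕ} (S : Set (Spc n)) (g : Spc n → ℝ) (p : ℝ) : ℝ≥0∞ :=
  (⨍⁻ x in S, ENNReal.ofReal (|g x| ^ p) ∂volume) ^ (1/p)

end

noncomputable section

/-- The time line with the parabolic metric. -/
def GwT : Type := ℝ

instance : TopologicalSpace GwT := inferInstanceAs (TopologicalSpace ℝ)
instance : MeasureSpace GwT := inferInstanceAs (MeasureSpace ℝ)

lemma gw_sqrt_add (a b : ℝ) (ha : 0 ≤ a) (hb : 0 ≤ b) : √(a + b) ≤ √a + √b := by
  rw [Real.sqrt_le_left (by positivity)]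
  nlinarith [Real.sq_sqrt ha, Real.sq_sqrt hb, Real.sqrt_nonneg a, Real.sqrt_nonneg b,
    mul_nonneg (Real.sqrt_nonneg a) (Real.sqrt_nonneg b)]

def gwd (s t : ℝ) : ℝ := √(2 * |s - t|)

lemma gwd_triangle (x y z : ℝ) : gwd x z ≤ gwd x y + gwd y z := by
  unfold gwd
  refine le_trans (Real.sqrt_le_sqrt ?_) (gw_sqrt_add _ _ (by positivity) (by positivity))
  have := abs_sub_le x y z
  linarith

lemma gwd_open (s : Set ℝ) : IsOpen s ↔ ∀ x ∈ s, ∃ ε > 0, ∀ y, gwd x y < ε → y ∈ s := by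
  unfold gwd
  rw [Metric.isOpen_iff]
  refine forall₂_congr fun x hx => ?_
  constructor
  · rintro ⟨e, he, h⟩
    refine ⟨√(2 * e), by positivity, fun y hy => h ?_⟩
    rw [Real.sqrt_lt_sqrt_iff (by positivity)] at hy
    rw [Metric.mem_ball, dist_comm, Real.dist_eq]
    linarith
  · rintro ⟨e, he, h⟩
    refine ⟨e^2/2, by positivity, fun y hy => h y ?_⟩
    rw [Metric.mem_ball, dist_comm, Real.dist_eq] at hy
    rw [Real.sqrt_lt' he]
    linarith

instance gwMetric : PseudoMetricSpace GwT :=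
  PseudoMetricSpace.ofDistTopology (α := GwT) gwd
    (fun x => by unfold gwd; exact (by simp : ∀ x : ℝ, √(2 * |x - x|) = 0) x)
    (fun x y => (by intro x y; simp [gwd, abs_sub_comm] : ∀ x y : ℝ, gwd x y = gwd y x) x y)
    gwd_triangle gwd_open

instance : BorelSpace GwT := inferInstanceAs (BorelSpace ℝ)
instance : SecondCountableTopology GwT := inferInstanceAs (SecondCountableTopology ℝ)
instance : SigmaFinite (volume : Measure GwT) := inferInstanceAs (SigmaFinite (volume : Measure ℝ))
instance : IsLocallyFiniteMeasure (volume : Measure GwT) :=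
  inferInstanceAs (IsLocallyFiniteMeasure (volume : Measure ℝ))

lemma gwd_le (t s r : ℝ) (hr : 0 ≤ r) : gwd s t ≤ r ↔ s ∈ Set.Icc (t - r^2/2) (t + r^2/2) := by
  unfold gwd
  rw [Real.sqrt_le_left hr]
  constructor
  · intro h
    have h2 := abs_le.1 (show |(s:ℝ) - t| ≤ r^2/2 by linarith)
    exact ⟨by linarith, by linarith⟩
  · rintro ⟨h1, h2⟩
    have := abs_le.2 (show -(r^2/2) ≤ (s:ℝ) - t ∧ (s:ℝ) - t ≤ r^2/2 from ⟨by linarith, by linarith⟩)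
    linarith

def gwI (t r : ℝ) : Set ℝ := Set.Icc (t - r^2/2) (t + r^2/2)

def gwC {n : ℕ} (z : Pt n) (r : ℝ) : Set (Pt n) := gwI z.1 r ×ˢ closedBall z.2 r

lemma gw_closedBall (t : GwT) (r : ℝ) (hr : 0 ≤ r) : closedBall t r = gwI t r :=
  Set.ext fun s => gwd_le t s r hr

lemma gw_vol_gwI (t r : ℝ) : volume (gwI t r) = ENNReal.ofReal (r^2) := by
  rw [gwI, Real.volume_Icc]
  congr 1; ring

lemma gw_vol_closedBallT (t : GwT) (r : ℝ) (hr : 0 ≤ r) :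
    volume (closedBall t r) = ENNReal.ofReal (r^2) :=
  (congrArg volume (gw_closedBall t r hr)).trans (gw_vol_gwI t r)

lemma gw_vol_closedBall {n : ℕ} (z : GwT × Spc n) (r : ℝ) (hr : 0 ≤ r) :
    volume (closedBall z r) = ENNReal.ofReal (r^2 * (2*r)^n) := by
  rw [← closedBall_prod_same, Measure.volume_eq_prod, Measure.prod_prod, gw_vol_closedBallT _ _ hr,
    Real.volume_pi_closedBall _ hr, ENNReal.ofReal_mul (by positivity)]
  simp

instance {n : ℕ} : IsUnifLocDoublingMeasure (volume : Measure (GwT × Spc n)) := by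
  refine ⟨⟨4 * 2^n, ?_⟩⟩
  filter_upwards [self_mem_nhdsWithin] with r hr x
  have hr' : (0:ℝ) < r := hr
  rw [gw_vol_closedBall _ _ (by positivity), gw_vol_closedBall _ _ hr'.le]
  rw [show ((4 * 2^n : ℝ≥0) : ℝ≥0∞) = ENNReal.ofReal (4 * 2^n) by
    rw [ENNReal.ofReal_mul (by norm_num), ENNReal.ofReal_pow (by norm_num)]; simp]
  rw [← ENNReal.ofReal_mul (by positivity)]
  apply ENNReal.ofReal_le_ofReal
  rw [mul_pow (2:ℝ) (2*r)]
  apply le_of_eq; ring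

lemma gw_vol_cyl {n : ℕ} (t : ℝ) (x : Spc n) (l r : ℝ) (hl : 0 ≤ l) (hr : 0 < r) :
    volume (cylinder t x l r) = ENNReal.ofReal (l * (2*r)^n) := by
  rw [_root_.cylinder, Measure.volume_eq_prod, Measure.prod_prod, tIv, Real.volume_Ioo,
    Real.volume_pi_ball _ hr, ENNReal.ofReal_mul hl]
  congr 1
  · congr 1; ring
  · simp

lemma gw_meas_cyl {n : ℕ} (t : ℝ) (x : Spc n) (l r : ℝ) :
    MeasurableSet (cylinder t x l r) := by
  unfold _root_.cylinder tIv
  exact measurableSet_Ioo.prod measurableSet_ball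

/-- Lebesgue differentiation along parabolic cylinders. -/
lemma gw_lebesgue {n : ℕ} (u : Pt n → ℝ) (hu : Integrable u) :
    ∀ᵐ z : Pt n, Tendsto (fun r : ℝ => ⨍ w in cylinder z.1 z.2 (r^2) r, u w) (𝓝[>] 0)
      (𝓝 (u z)) := by
  have h1 : LocallyIntegrable (X := GwT × Spc n) u volume :=
    Integrable.locallyIntegrable (X := GwT × Spc n) hu
  have h2 := IsUnifLocDoublingMeasure.ae_tendsto_average (α := GwT × Spc n) volume h1 1
  have hC : ∀ (z : GwT × Spc n) (r : ℝ), 0 ≤ r → closedBall z r = gwC (n := n) z r := by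
    intro z r hr
    refine (closedBall_prod_same (α := GwT) (β := Spc n) z.1 z.2 r).symm.trans ?_
    exact congrArg (fun S : Set GwT => S ×ˢ closedBall z.2 r) (gw_closedBall z.1 r hr)
  have h3 : ∀ᵐ z : GwT × Spc n, Tendsto (fun r : ℝ => ⨍ w in gwC (n := n) z r, u w) (𝓝[>] 0)
      (𝓝 (u z)) := by
    filter_upwards [h2] with z hz
    refine (hz (fun _ => z) id tendsto_id ?_).congr' ?_
    · filter_upwards [self_mem_nhdsWithin] with r hr
      have : (0:ℝ) < r := hr
      simp [this.le]
    · filter_upwards [self_mem_nhdsWithin] with r hr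
      have : (0:ℝ) < r := hr
      exact congrArg (fun S : Set (GwT × Spc n) => ⨍ w in S, u w ∂volume) (hC z r this.le)
  have h4 : ∀ᵐ z : Pt n, Tendsto (fun r : ℝ => ⨍ w in gwC z r, u w) (𝓝[>] 0)
      (𝓝 (u z)) := h3
  filter_upwards [h4] with z hz
  refine hz.congr' ?_
  filter_upwards [self_mem_nhdsWithin] with r hr
  have hr' : (0:ℝ) < r := hr
  apply setAverage_congr
  symm
  have hvc : volume (gwC z r) = ENNReal.ofReal (r^2 * (2*r)^n) := by
    rw [gwC, Measure.volume_eq_prod, Measure.prod_prod, gw_vol_gwI,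
      Real.volume_pi_closedBall _ hr'.le, ENNReal.ofReal_mul (by positivity)]
    simp
  apply ae_eq_of_subset_of_measure_ge
  · exact Set.prod_mono Ioo_subset_Icc_self ball_subset_closedBall
  · rw [hvc, gw_vol_cyl _ _ _ _ (by positivity) hr']
  · exact (gw_meas_cyl _ _ _ _).nullMeasurableSet
  · rw [hvc]; exact ENNReal.ofReal_ne_top

end

noncomputable section

/-- Vitali covering for dilated parabolic cylinders. -/
lemma gw_vitali {n : ℕ} (T : Set (Pt n)) (ρ : Pt n → ℝ) (R : ℝ) (h0 : ∀ z ∈ T, 0 < ρ z)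
    (hR : ∀ z ∈ T, ρ z ≤ R) (a b : ℝ) (ha : 0 < a) (hb : 0 < b) :
    ∃ U ⊆ T, U.Countable ∧
      U.PairwiseDisjoint (fun z => cylinder z.1 z.2 (a * ρ z ^ 2) (b * ρ z)) ∧
      ∀ z ∈ T, ∃ w ∈ U, cylinder z.1 z.2 (a * ρ z ^ 2) (b * ρ z) ⊆
        cylinder w.1 w.2 (a * (5 * ρ w) ^ 2) (b * (5 * ρ w)) := by
  have hne : ∀ z ∈ T, (cylinder z.1 z.2 (a * ρ z ^ 2) (b * ρ z)).Nonempty := by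
    intro z hz
    have := h0 z hz
    have h1 : 0 < a * ρ z ^ 2 := by positivity
    have h2 : 0 < b * ρ z := by positivity
    exact ⟨z, ⟨⟨by linarith, by linarith⟩, mem_ball_self h2⟩⟩
  obtain ⟨U, hUT, hd, hc⟩ := Vitali.exists_disjoint_subfamily_covering_enlargement
    (fun z : Pt n => cylinder z.1 z.2 (a * ρ z ^ 2) (b * ρ z)) T ρ 2 (by norm_num)
    (fun z hz => (h0 z hz).le) R hR hne
  refine ⟨U, hUT, ?_, hd, ?_⟩
  · refine hd.countable_of_isOpen (fun z _ => ?_) (fun z hz => hne z (hUT hz))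
    exact isOpen_Ioo.prod isOpen_ball
  · intro z hz
    obtain ⟨w, hw, ⟨y, hyz, hyw⟩, hle⟩ := hc z hz
    refine ⟨w, hw, ?_⟩
    have hz0 := h0 z hz
    have hw0 := h0 w (hUT hw)
    have hsq : ρ z ^ 2 ≤ 4 * ρ w ^ 2 := by nlinarith
    have hsq' : a * ρ z ^ 2 ≤ 4 * (a * ρ w ^ 2) := by nlinarith
    have hb' : b * ρ z ≤ 2 * (b * ρ w) := by nlinarith
    have hbw : 0 < b * ρ w := by positivity
    have haw : 0 < a * ρ w ^ 2 := by positivity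
    rintro v ⟨⟨hv1, hv2⟩, hv3⟩
    obtain ⟨⟨hz1, hz2⟩, hz3⟩ := hyz
    obtain ⟨⟨hw1, hw2⟩, hw3⟩ := hyw
    have e : a * (5 * ρ w) ^ 2 = 25 * (a * ρ w ^ 2) := by ring
    refine ⟨⟨?_, ?_⟩, ?_⟩
    · rw [e]; linarith
    · rw [e]; linarith
    · rw [mem_ball] at *
      have t1 := dist_triangle v.2 z.2 w.2
      have t2 := dist_triangle_left z.2 w.2 y.2
      linarith

lemma gw_weak_j {n : ℕ} (ν : Measure (Pt n)) (T : Set (Pt n)) (ρ : Pt n → ℝ) (R : ℝ)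
    (h0 : ∀ z ∈ T, 0 < ρ z)
    (hR : ∀ z ∈ T, ρ z ≤ R) (a b : ℝ) (ha : 0 < a) (hb : 0 < b) (m : ℝ) 
    (hm : ∀ z ∈ T, ENNReal.ofReal m * volume (cylinder z.1 z.2 (a * ρ z ^ 2) (b * ρ z)) ≤
      ν (cylinder z.1 z.2 (a * ρ z ^ 2) (b * ρ z))) :
    ENNReal.ofReal m * volume (⋃ z ∈ T, cylinder z.1 z.2 (a * ρ z ^ 2) (b * ρ z)) ≤
      ENNReal.ofReal (25 * 5 ^ n) * ν univ := by
  obtain ⟨U, hUT, hcount, hd, hc⟩ := gw_vitali T ρ R h0 hR a b ha hb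
  have hsub : (⋃ z ∈ T, cylinder z.1 z.2 (a * ρ z ^ 2) (b * ρ z)) ⊆
      ⋃ w ∈ U, cylinder w.1 w.2 (a * (5 * ρ w) ^ 2) (b * (5 * ρ w)) := by
    refine iUnion₂_subset fun z hz => ?_
    obtain ⟨w, hw, hs⟩ := hc z hz
    exact hs.trans (subset_biUnion_of_mem (u := fun w : Pt n => cylinder w.1 w.2 (a * (5 * ρ w) ^ 2) (b * (5 * ρ w))) hw)
  have : Countable U := hcount.to_subtype
  calc ENNReal.ofReal m * volume (⋃ z ∈ T, cylinder z.1 z.2 (a * ρ z ^ 2) (b * ρ z))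
      ≤ ENNReal.ofReal m * ∑' w : U, volume (cylinder w.1.1 w.1.2 (a * (5 * ρ w) ^ 2) (b * (5 * ρ w))) := by
        gcongr
        refine (measure_mono hsub).trans ?_
        exact measure_biUnion_le volume hcount _
    _ = ∑' w : U, ENNReal.ofReal (25 * 5 ^ n) *
          (ENNReal.ofReal m * volume (cylinder w.1.1 w.1.2 (a * ρ w ^ 2) (b * ρ w))) := by
        rw [← ENNReal.tsum_mul_left]
        refine tsum_congr fun w => ?_
        have hw0 := h0 w (hUT w.2)
        rw [gw_vol_cyl _ _ _ _ (by positivity) (by positivity),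
          gw_vol_cyl _ _ _ _ (by positivity) (by positivity)]
        rw [mul_left_comm (ENNReal.ofReal (25 * 5 ^ n)),
          ← ENNReal.ofReal_mul (p := 25 * 5 ^ n) (by positivity)]
        congr 2
        rw [show 2 * (b * (5 * ρ w)) = 5 * (2 * (b * ρ w)) by ring, mul_pow 5 (2 * (b * ρ w))]
        generalize (2 * (b * ρ w)) ^ n = Y
        ring
    _ ≤ ∑' w : U, ENNReal.ofReal (25 * 5 ^ n) * ν (cylinder w.1.1 w.1.2 (a * ρ w ^ 2) (b * ρ w)) := by
        gcongr with w
        exact hm w (hUT w.2)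
    _ = ENNReal.ofReal (25 * 5 ^ n) * ν (⋃ w ∈ U, cylinder w.1 w.2 (a * ρ w ^ 2) (b * ρ w)) := by
        rw [ENNReal.tsum_mul_left, measure_biUnion hcount hd (fun w _ => gw_meas_cyl _ _ _ _)]
    _ ≤ _ := by
        gcongr
        exact subset_univ _

lemma gw_tail_le {n : ℕ} (γ : ℝ) (u : Pt n → ℝ) (hu : ∀ z, 0 ≤ u z) (t : ℝ) (x : Spc n) (r : ℝ)
    (c : ℕ → ℝ) (b : ℝ) 
    (hc : ∀ j : ℕ, (⨍ z in cylinder t x ((4:ℝ)^j * r^2) (γ * r), u z) ≤ c j)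
    (hs : HasSum (fun j : ℕ => ((2:ℝ)⁻¹) ^ (j+1) * c j) b) : tailAvg γ u t x r ≤ b := by
  unfold tailAvg
  have hnn : ∀ j : ℕ, 0 ≤ ((2:ℝ)⁻¹) ^ (j+1) * ⨍ z in cylinder t x ((4:ℝ)^j * r^2) (γ * r), u z := by
    intro j
    have : 0 ≤ ⨍ z in cylinder t x ((4:ℝ)^j * r^2) (γ * r), u z := integral_nonneg hu
    positivity
  have hle : ∀ j : ℕ, ((2:ℝ)⁻¹) ^ (j+1) * (⨍ z in cylinder t x ((4:ℝ)^j * r^2) (γ * r), u z)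
      ≤ ((2:ℝ)⁻¹) ^ (j+1) * c j := fun j => mul_le_mul_of_nonneg_left (hc j) (by positivity)
  rw [← hs.tsum_eq]
  exact Summable.tsum_le_tsum hle (Summable.of_nonneg_of_le hnn hle hs.summable) hs.summable

lemma gw_tail_gt {n : ℕ} (γ : ℝ) (u : Pt n → ℝ) (hu : ∀ z, 0 ≤ u z) (t : ℝ) (x : Spc n) (r : ℝ)
    (μ : ℝ) (h : 2 * μ < tailAvg γ u t x r) :
    ∃ j : ℕ, (3/2 : ℝ)^j * μ < ⨍ z in cylinder t x ((4:ℝ)^j * r^2) (γ * r), u z := by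
  by_contra! hc
  refine absurd (gw_tail_le γ u hu t x r _ (2 * μ) hc ?_) (not_le.2 h)
  have h1 := (hasSum_geometric_of_lt_one (r := (3/4:ℝ)) (by norm_num) (by norm_num)).mul_left (μ/2)
  rw [show μ / 2 * (1 - 3 / 4 : ℝ)⁻¹ = 2 * μ by norm_num; ring] at h1
  have e : (fun i : ℕ => μ / 2 * (3 / 4 : ℝ) ^ i)
      = fun j : ℕ => ((2:ℝ)⁻¹) ^ (j+1) * ((3/2 : ℝ)^j * μ) := by
    funext j
    rw [show (3/4:ℝ) = 2⁻¹ * (3/2) by norm_num, mul_pow, pow_succ]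
    ring
  rw [e] at h1
  exact h1

lemma gw_avg_gt {n : ℕ} (S : Set (Pt n)) (u : Pt n → ℝ) (hu : ∀ z, 0 ≤ u z) (m : ℝ) (hm : 0 ≤ m)
    (hS : volume S ≠ ∞) (h : m < ⨍ z in S, u z) :
    ENNReal.ofReal m * volume S ≤ ∫⁻ z in S, ENNReal.ofReal (u z) := by
  rw [setAverage_eq, smul_eq_mul] at h
  have hintg : IntegrableOn u S := by
    by_contra hni
    rw [integral_undef hni, mul_zero] at h
    linarith
  rw [← ofReal_integral_eq_lintegral_ofReal hintg (ae_of_all _ hu)]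
  have hpos : 0 < volume.real S := by
    by_contra hn
    have : volume.real S = 0 := le_antisymm (not_lt.1 hn) measureReal_nonneg
    rw [this] at h
    simp at h; linarith
  rw [← ENNReal.ofReal_toReal hS, ← ENNReal.ofReal_mul hm]
  apply ENNReal.ofReal_le_ofReal
  change m * volume.real S ≤ _
  rw [inv_mul_eq_div, lt_div_iff₀ hpos] at h
  exact h.le

/-- Weak type bound for the tail functional. -/
lemma gw_weak {n : ℕ} (γ : ℝ) (hγ : 1 < γ) (u : Pt n → ℝ) (hu : ∀ z, 0 ≤ u z) 
    (T : Set (Pt n)) (ρ : Pt n → ℝ) (R : ℝ)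
    (h0 : ∀ z ∈ T, 0 < ρ z) (hR : ∀ z ∈ T, ρ z ≤ R) (μ : ℝ) (hμ : 0 < μ) (hum : AEMeasurable u)
    (ht : ∀ z ∈ T, 2 * μ < tailAvg γ u z.1 z.2 (ρ z)) :
    ENNReal.ofReal μ * volume (⋃ z ∈ T, cylinder z.1 z.2 (ρ z ^ 2) (ρ z)) ≤
      ENNReal.ofReal (150 * 5 ^ n) * (volume.withDensity (fun z => ENNReal.ofReal (u z)))
        {z | μ / 2 < u z} := by
  set ν := (volume.withDensity (fun z => ENNReal.ofReal (u z))) with hν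
  have hj : ∀ z ∈ T, ∃ j : ℕ, (3/2 : ℝ)^j * μ < ⨍ z in cylinder z.1 z.2 ((4:ℝ)^j * ρ z^2) (γ * ρ z), u z :=
    fun z hz => gw_tail_gt γ u hu _ _ _ μ (ht z hz)
  let Tj : ℕ → Set (Pt n) := fun j => {z ∈ T | (3/2 : ℝ)^j * μ < ⨍ z in cylinder z.1 z.2 ((4:ℝ)^j * ρ z^2) (γ * ρ z), u z}
  have hms : NullMeasurableSet {z | μ / 2 < u z} volume :=
    nullMeasurableSet_lt aemeasurable_const hum
  have key : ∀ j, ENNReal.ofReal μ * volume (⋃ z ∈ Tj j, cylinder z.1 z.2 (ρ z ^ 2) (ρ z)) ≤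
      ENNReal.ofReal (50 * 5 ^ n * (2/3)^j) * ν {z | μ / 2 < u z} := by
    intro j
    have h1 := gw_weak_j (ν.restrict {z | μ / 2 < u z}) (Tj j) ρ R (fun z hz => h0 z hz.1) (fun z hz => hR z hz.1)
      ((4:ℝ)^j) γ (by positivity) (by positivity) ((3/2 : ℝ)^j * μ / 2) ?_
    · rw [Measure.restrict_apply_univ] at h1
      have hsub : (⋃ z ∈ Tj j, cylinder z.1 z.2 (ρ z ^ 2) (ρ z)) ⊆
          ⋃ z ∈ Tj j, cylinder z.1 z.2 ((4:ℝ)^j * ρ z ^ 2) (γ * ρ z) := by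
        refine iUnion₂_mono fun z hz => ?_
        have hz0 := h0 z hz.1
        have h4 : (1:ℝ) ≤ 4^j := one_le_pow₀ (by norm_num)
        have h5 : ρ z ^ 2 ≤ 4^j * ρ z ^ 2 := le_mul_of_one_le_left (by positivity) h4
        refine Set.prod_mono (Ioo_subset_Ioo (by linarith) (by linarith)) (ball_subset_ball ?_)
        nlinarith
      calc ENNReal.ofReal μ * volume (⋃ z ∈ Tj j, cylinder z.1 z.2 (ρ z ^ 2) (ρ z))
          ≤ ENNReal.ofReal μ * volume (⋃ z ∈ Tj j, cylinder z.1 z.2 ((4:ℝ)^j * ρ z ^ 2) (γ * ρ z)) := by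
            gcongr
        _ = ENNReal.ofReal (2 * (2/3)^j) * (ENNReal.ofReal ((3/2 : ℝ)^j * μ / 2) * volume (⋃ z ∈ Tj j, cylinder z.1 z.2 ((4:ℝ)^j * ρ z ^ 2) (γ * ρ z))) := by
            rw [← mul_assoc, ← ENNReal.ofReal_mul (by positivity)]
            congr 2
            have : (2/3:ℝ)^j * (3/2)^j = 1 := by rw [← mul_pow]; norm_num
            linear_combination (-μ) * this
        _ ≤ ENNReal.ofReal (2 * (2/3)^j) * (ENNReal.ofReal (25 * 5 ^ n) * ν {z | μ / 2 < u z}) := by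
            gcongr
        _ = _ := by
            rw [← mul_assoc, ← ENNReal.ofReal_mul (by positivity)]
            congr 2
            ring
    · rintro z ⟨hzT, hz⟩
      have hz0 := h0 z hzT
      set S := cylinder z.1 z.2 ((4:ℝ)^j * ρ z ^ 2) (γ * ρ z) with hS
      have hSm : MeasurableSet S := gw_meas_cyl _ _ _ _
      have hSv : volume S ≠ ∞ := by
        rw [hS, gw_vol_cyl _ _ _ _ (by positivity) (by positivity)]; exact ENNReal.ofReal_ne_top
      have h2 := gw_avg_gt S u hu _ (by positivity) hSv hz
      have h3 : ∫⁻ z in S, ENNReal.ofReal (u z) ≤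
          (∫⁻ z in S ∩ {z | μ / 2 < u z}, ENNReal.ofReal (u z)) + ENNReal.ofReal (μ/2) * volume S := by
        have hsplit : S = (S ∩ {z | μ / 2 < u z}) ∪ (S ∩ {z | u z ≤ μ / 2}) := by
          ext w; simp only [mem_union, mem_inter_iff, mem_ofPred_eq]
          rcases lt_or_ge (μ/2) (u w) with h | h <;> simp [h, not_lt.2, not_le.2]
        conv_lhs => rw [hsplit]
        refine (lintegral_union_le _ _ _).trans ?_
        gcongr
        calc ∫⁻ z in S ∩ {z | u z ≤ μ / 2}, ENNReal.ofReal (u z) 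
            ≤ ∫⁻ z in S ∩ {z | u z ≤ μ / 2}, ENNReal.ofReal (μ/2) := by
              refine lintegral_mono_ae ((ae_restrict_iff'₀ (hSm.nullMeasurableSet.inter
                (nullMeasurableSet_le hum aemeasurable_const))).2 ?_)
              exact ae_of_all _ fun w hw => ENNReal.ofReal_le_ofReal hw.2
          _ ≤ _ := by
              rw [setLIntegral_const]
              gcongr
              exact inter_subset_left
      rw [Measure.restrict_apply hSm, withDensity_apply', inter_comm] 
      rw [inter_comm]
      have h4 : ENNReal.ofReal ((3/2)^j * μ / 2) * volume S + ENNReal.ofReal (μ/2) * volume S ≤ (∫⁻ z in S ∩ {z | μ / 2 < u z}, ENNReal.ofReal (u z)) + ENNReal.ofReal (μ/2) * volume S := by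
        refine le_trans ?_ (h2.trans h3)
        rw [← add_mul, ← ENNReal.ofReal_add (by positivity) (by positivity)]
        gcongr
        have : (1:ℝ) ≤ (3/2)^j := one_le_pow₀ (by norm_num)
        nlinarith
      exact (ENNReal.add_le_add_iff_right (ENNReal.mul_ne_top ENNReal.ofReal_ne_top hSv)).1 h4
  have hcov : (⋃ z ∈ T, cylinder z.1 z.2 (ρ z ^ 2) (ρ z)) ⊆
      ⋃ j, ⋃ z ∈ Tj j, cylinder z.1 z.2 (ρ z ^ 2) (ρ z) := by
    refine iUnion₂_subset fun z hz => ?_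
    obtain ⟨j, hj⟩ := hj z hz
    refine subset_iUnion_of_subset j ?_
    exact subset_biUnion_of_mem (u := fun z : Pt n => cylinder z.1 z.2 (ρ z ^ 2) (ρ z)) (show z ∈ Tj j from ⟨hz, hj⟩)
  calc ENNReal.ofReal μ * volume (⋃ z ∈ T, cylinder z.1 z.2 (ρ z ^ 2) (ρ z))
      ≤ ENNReal.ofReal μ * ∑' j, volume (⋃ z ∈ Tj j, cylinder z.1 z.2 (ρ z ^ 2) (ρ z)) := by
        gcongr
        exact (measure_mono hcov).trans (measure_iUnion_le _)
    _ = ∑' j, ENNReal.ofReal μ * volume (⋃ z ∈ Tj j, cylinder z.1 z.2 (ρ z ^ 2) (ρ z)) := by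
        rw [ENNReal.tsum_mul_left]
    _ ≤ ∑' j : ℕ, ENNReal.ofReal (50 * 5 ^ n * (2/3)^j) * ν {z | μ / 2 < u z} :=
        ENNReal.tsum_le_tsum key
    _ = _ := by
        rw [ENNReal.tsum_mul_right]
        congr 1
        have h1 := (hasSum_geometric_of_lt_one (r := (2/3:ℝ)) (by norm_num) (by norm_num)).mul_left (50 * 5^n)
        rw [← ENNReal.ofReal_tsum_of_nonneg (fun j => by positivity) h1.summable, h1.tsum_eq]
        congr 1; ring

end

noncomputable section

lemma gw_avg_eq {n : ℕ} (u : Pt n → ℝ) (t : ℝ) (x : Spc n) (r : ℝ) (hr : 0 < r) :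
    (⨍ z in cylinder t x (r^2) r, u z) * (r^2 * (2*r)^n) = ∫ z in cylinder t x (r^2) r, u z := by
  have hv : volume.real (cylinder t x (r^2) r) = r^2 * (2*r)^n := by
    rw [measureReal_def, gw_vol_cyl _ _ _ _ (by positivity) hr, ENNReal.toReal_ofReal (by positivity)]
  have : 0 < r^2 * (2*r)^n := by positivity
  rw [setAverage_eq, smul_eq_mul, hv]
  field_simp

lemma gw_radius {n : ℕ} (u : Pt n → ℝ) (hu : ∀ z, 0 ≤ u z) (hi : Integrable u) (m : ℝ) (hm : 0 < m)
    (t : ℝ) (x : Spc n) (r : ℝ) (hr : 0 < r) (h : m < ⨍ z in cylinder t x (r^2) r, u z) :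
    r ≤ max 1 ((∫ z, u z) / m) := by
  rcases le_total r 1 with h1 | h1
  · exact h1.trans (le_max_left _ _)
  · refine le_trans ?_ (le_max_right _ _)
    rw [le_div_iff₀ hm]
    have e := gw_avg_eq u t x r hr
    have e2 : ∫ z in cylinder t x (r^2) r, u z ≤ ∫ z, u z :=
      setIntegral_le_integral hi (ae_of_all _ hu)
    have e3 : r ≤ r^2 * (2*r)^n := by
      have a1 : (1:ℝ) ≤ (2*r)^n := one_le_pow₀ (by linarith)
      have a2 : r ≤ r^2 := by nlinarith
      nlinarith
    calc r * m ≤ (r^2 * (2*r)^n) * m := by gcongr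
      _ ≤ (⨍ z in cylinder t x (r^2) r, u z) * (r^2 * (2*r)^n) := by
        rw [mul_comm]; gcongr
      _ ≤ _ := by rw [e]; exact e2

lemma gw_stop {n : ℕ} (u : Pt n → ℝ) (hu : ∀ z, 0 ≤ u z) (hi : Integrable u) (m : ℝ) (hm : 0 < m)
    (z : Pt n) (hz : m < u z)
    (hl : Tendsto (fun r : ℝ => ⨍ w in cylinder z.1 z.2 (r^2) r, u w) (𝓝[>] 0) (𝓝 (u z))) :
    ∃ r : ℝ, 0 < r ∧ m < (⨍ w in cylinder z.1 z.2 (r^2) r, u w) ∧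
      (⨍ w in cylinder z.1 z.2 ((5*r)^2) (5*r), u w) ≤ m := by
  have h1 := (hl.eventually_const_lt hz).and self_mem_nhdsWithin
  obtain ⟨r0, hr0, hr0'⟩ := h1.exists
  have hr0p : (0:ℝ) < r0 := hr0'
  classical
  have hex : ∃ k : ℕ, ¬ (m < ⨍ w in cylinder z.1 z.2 ((5^k * r0)^2) (5^k * r0), u w) := by
    obtain ⟨k, hk⟩ := pow_unbounded_of_one_lt (max 1 ((∫ z, u z) / m) / r0) (by norm_num : (1:ℝ) < 5)
    refine ⟨k, fun hlt => ?_⟩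
    have := gw_radius u hu hi m hm _ _ _ (by positivity) hlt
    rw [div_lt_iff₀ hr0p] at hk
    linarith
  have hs := Nat.find_spec hex
  have hne : Nat.find hex ≠ 0 := by
    intro h0
    rw [h0] at hs
    simp only [pow_zero, one_mul] at hs
    exact hs hr0
  obtain ⟨k, hk⟩ := Nat.exists_eq_succ_of_ne_zero hne
  have hmin := Nat.find_min hex (m := k) (by omega)
  rw [hk] at hs
  refine ⟨5^k * r0, by positivity, not_not.1 hmin, ?_⟩
  rw [← mul_assoc, ← pow_succ']
  exact not_lt.1 hs

/-- Calderón–Zygmund type selection. -/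
lemma gw_cz {n : ℕ} (u : Pt n → ℝ) (hu : ∀ z, 0 ≤ u z) (hi : Integrable u) (m : ℝ) (hm : 0 < m) :
    ∃ (U : Set (Pt n)) (ρ : Pt n → ℝ) (R : ℝ), (∀ z ∈ U, 0 < ρ z) ∧ (∀ z ∈ U, ρ z ≤ R) ∧
      (∀ z ∈ U, m < ⨍ w in cylinder z.1 z.2 (ρ z^2) (ρ z), u w) ∧
      (volume.withDensity (fun z => ENNReal.ofReal (u z))) {z | m < u z} ≤
        ENNReal.ofReal (25 * 5^n * m) * volume (⋃ z ∈ U, cylinder z.1 z.2 (ρ z ^ 2) (ρ z)) := by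
  classical
  set ν := (volume.withDensity (fun z => ENNReal.ofReal (u z))) with hν
  let T : Set (Pt n) := {z | m < u z ∧ Tendsto (fun r : ℝ => ⨍ w in cylinder z.1 z.2 (r^2) r, u w) (𝓝[>] 0) (𝓝 (u z))}
  have hst : ∀ z : Pt n, ∃ r : ℝ, z ∈ T → (0 < r ∧ m < (⨍ w in cylinder z.1 z.2 (r^2) r, u w) ∧
      (⨍ w in cylinder z.1 z.2 ((5*r)^2) (5*r), u w) ≤ m) := by
    intro z
    by_cases hz : z ∈ T
    · obtain ⟨r, hr⟩ := gw_stop u hu hi m hm z hz.1 hz.2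
      exact ⟨r, fun _ => hr⟩
    · exact ⟨0, fun h => absurd h hz⟩
  choose ρ hρ using hst
  set R := max 1 ((∫ z, u z) / m)
  have hR : ∀ z ∈ T, ρ z ≤ R := fun z hz =>
    gw_radius u hu hi m hm _ _ _ (hρ z hz).1 (hρ z hz).2.1
  obtain ⟨U, hUT, hcount, hd, hc⟩ := gw_vitali T ρ R (fun z hz => (hρ z hz).1) hR 1 1 one_pos one_pos
  simp only [one_mul] at hd hc
  refine ⟨U, ρ, R, fun z hz => (hρ z (hUT hz)).1, fun z hz => hR z (hUT hz),
    fun z hz => (hρ z (hUT hz)).2.1, ?_⟩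
  have hac : ν ≪ volume := withDensity_absolutelyContinuous _ _
  have hsub : {z | m < u z} ≤ᵐ[ν] ⋃ w ∈ U, cylinder w.1 w.2 ((5 * ρ w) ^ 2) (5 * ρ w) := by
    filter_upwards [hac.ae_le (gw_lebesgue u hi)] with z hz hzu
    have hzT : z ∈ T := ⟨hzu, hz⟩
    obtain ⟨w, hw, hs⟩ := hc z hzT
    have hzz : z ∈ cylinder z.1 z.2 (ρ z ^ 2) (ρ z) := by
      have h0 := (hρ z hzT).1
      have h1 : 0 < ρ z ^ 2 := by positivity
      exact ⟨⟨by linarith, by linarith⟩, mem_ball_self h0⟩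
    exact mem_biUnion (x := w) (t := fun w : Pt n => cylinder w.1 w.2 ((5 * ρ w) ^ 2) (5 * ρ w)) hw (hs hzz)
  have : Countable U := hcount.to_subtype
  calc ν {z | m < u z} ≤ ν (⋃ w ∈ U, cylinder w.1 w.2 ((5 * ρ w) ^ 2) (5 * ρ w)) :=
        measure_mono_ae hsub
    _ ≤ ∑' w : U, ν (cylinder w.1.1 w.1.2 ((5 * ρ w) ^ 2) (5 * ρ w)) := measure_biUnion_le ν hcount _
    _ ≤ ∑' w : U, ENNReal.ofReal (25 * 5^n * m) * volume (cylinder w.1.1 w.1.2 (ρ w ^ 2) (ρ w)) := by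
        gcongr with w
        obtain ⟨p0, p1, p2⟩ := hρ w (hUT w.2)
        rw [withDensity_apply', ← ofReal_integral_eq_lintegral_ofReal hi.integrableOn (ae_of_all _ hu),
          ← gw_avg_eq u _ _ _ (by positivity), gw_vol_cyl _ _ _ _ (by positivity) p0,
          ← ENNReal.ofReal_mul (by positivity)]
        apply ENNReal.ofReal_le_ofReal
        calc _ ≤ m * ((5 * ρ w)^2 * (2 * (5 * ρ w))^n) := by gcongr
          _ = _ := by
            rw [show 2 * (5 * ρ w) = 5 * (2 * ρ w) by ring, mul_pow 5 (2 * ρ w)]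
            generalize (2 * ρ w)^n = Y
            ring
    _ = _ := by
        rw [ENNReal.tsum_mul_left, measure_biUnion hcount hd (fun w _ => gw_meas_cyl _ _ _ _)]

lemma gw_holder {n : ℕ} (S : Set (Pt n)) (h : Pt n → ℝ) (hh : ∀ z, 0 ≤ h z) (hm : AEMeasurable h)
    (s P : ℝ) (hs : 0 < s) (hP : s < P) :
    ∫⁻ z in S, ENNReal.ofReal (h z ^ s) ≤
      (∫⁻ z, ENNReal.ofReal (h z ^ P)) ^ (s/P) * volume S ^ (1 - s/P) := by
  have hP0 : 0 < P := hs.trans hP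
  have hc : (P/s).HolderConjugate (1 - s/P)⁻¹ := by
    rw [Real.holderConjugate_iff]
    refine ⟨by rw [one_lt_div hs]; exact hP, ?_⟩
    field_simp
    ring
  have hmS : AEMeasurable (fun z => ENNReal.ofReal (h z ^ s)) (volume.restrict S) :=
    ((hm.pow_const s).ennreal_ofReal).restrict
  have h1 := ENNReal.lintegral_mul_le_Lp_mul_Lq (volume.restrict S) hc hmS
    (aemeasurable_const (b := (1:ℝ≥0∞)))
  simp only [Pi.mul_apply, mul_one, ENNReal.one_rpow, lintegral_const, Measure.restrict_apply_univ,
    one_mul, one_div, inv_inv, inv_div] at h1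
  refine h1.trans ?_
  gcongr ?_ ^ _ * _
  · refine (setLIntegral_le_lintegral S _).trans (lintegral_mono fun z => ?_)
    rw [ENNReal.ofReal_rpow_of_nonneg (Real.rpow_nonneg (hh z) _) (by positivity),
      ← Real.rpow_mul (hh z)]
    apply le_of_eq
    congr 2
    field_simp

lemma gw_tail_nonneg {n : ℕ} (γ : ℝ) (u : Pt n → ℝ) (hu : ∀ z, 0 ≤ u z) (t : ℝ) (x : Spc n) (r : ℝ) :
    0 ≤ tailAvg γ u t x r := by
  refine tsum_nonneg fun j => ?_
  have : 0 ≤ ⨍ z in cylinder t x ((4:ℝ)^j * r^2) (γ * r), u z := integral_nonneg hu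
  positivity

lemma gw_tail_hold {n : ℕ} (γ : ℝ) (hγ : 1 < γ) (h : Pt n → ℝ) (hh : ∀ z, 0 ≤ h z)
    (hm : AEMeasurable h)
    (s P : ℝ) (hs : 0 < s) (hP : s < P) (M : ℝ) (hM : 0 < M)
    (hMi : ∫⁻ z, ENNReal.ofReal (h z ^ P) ≤ ENNReal.ofReal M)
    (t : ℝ) (x : Spc n) (r : ℝ) (hr : 0 < r) :
    tailAvg γ (fun z => h z ^ s) t x r ≤ (M / r^((n:ℝ)+2)) ^ (s/P) := by
  have hP0 : 0 < P := hs.trans hP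
  refine gw_tail_le γ _ (fun z => Real.rpow_nonneg (hh z) _) t x r
    (fun _ => (M / r^((n:ℝ)+2)) ^ (s/P)) _ ?_ ?_
  · intro j
    refine le_of_forall_gt_imp_ge_of_dense fun m hmgt => ?_
    by_contra! hlt
    have hm0 : 0 < m := lt_of_le_of_lt (by positivity) hmgt
    set S := cylinder t x ((4:ℝ)^j * r^2) (γ * r) with hS
    set V : ℝ := (4:ℝ)^j * r^2 * (2 * (γ * r))^n with hV
    have hVp : 0 < V := by positivity
    have hSv : volume S = ENNReal.ofReal V := gw_vol_cyl _ _ _ _ (by positivity) (by positivity)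
    have h1 := gw_avg_gt S _ (fun z => Real.rpow_nonneg (hh z) _) m hm0.le
      (by rw [hSv]; exact ENNReal.ofReal_ne_top) hlt
    have h2 := h1.trans (gw_holder S h hh hm s P hs hP)
    have hsP : s / P < 1 := by rw [div_lt_one hP0]; exact hP
    have h3 : ENNReal.ofReal m * ENNReal.ofReal V ≤ ENNReal.ofReal M ^ (s/P) * ENNReal.ofReal V ^ (1 - s/P) := by
      rw [hSv] at h2
      refine h2.trans ?_
      gcongr
    rw [ENNReal.ofReal_rpow_of_pos hM, ENNReal.ofReal_rpow_of_pos hVp,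
      ← ENNReal.ofReal_mul hm0.le, ← ENNReal.ofReal_mul (by positivity),
      ENNReal.ofReal_le_ofReal_iff (by positivity), Real.rpow_sub hVp, Real.rpow_one] at h3
    have hVr : r^((n:ℝ)+2) ≤ V := by
      rw [Real.rpow_add hr, Real.rpow_natCast, Real.rpow_two, hV]
      have a1 : (1:ℝ) ≤ 4^j := one_le_pow₀ (by norm_num)
      have a2 : r ^ n ≤ (2 * (γ * r))^n := by
        gcongr; nlinarith
      calc r^n * r^2 = 1 * r^2 * r^n := by ring
        _ ≤ _ := by gcongr
    have h4 : m ≤ (M / V)^(s/P) := by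
      rw [Real.div_rpow hM.le hVp.le]
      have : 0 < V ^ (s/P) := by positivity
      rw [mul_div_assoc', mul_comm (M ^ _), mul_div_assoc, mul_comm m] at h3
      exact le_of_mul_le_mul_left h3 hVp
    have h5 : (M / V)^(s/P) ≤ (M / r^((n:ℝ)+2)) ^ (s/P) := by gcongr
    linarith
  · have h1 := (hasSum_geometric_of_lt_one (r := (2⁻¹:ℝ)) (by norm_num) (by norm_num)).mul_left
      (2⁻¹ * (M / r^((n:ℝ)+2)) ^ (s/P))
    rw [show 2⁻¹ * (M / r^((n:ℝ)+2)) ^ (s/P) * (1 - 2⁻¹ : ℝ)⁻¹ = (M / r^((n:ℝ)+2)) ^ (s/P) by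
      norm_num; ring] at h1
    refine h1.congr_fun ?_
    intro j
    rw [pow_succ]; ring

lemma gw_hedberg (d s P M r a l : ℝ) (hs : 0 < s) (hP : s < P) (hd : P < d) (hM : 0 < M)
    (hr : 0 < r) (hl : 0 < l) (ha : 0 ≤ a) (h1 : a ≤ (M / r^d) ^ (s/P)) (h2 : l < r * a ^ (1/s)) :
    (l^d / M) ^ (s/(d-P)) < a := by
  have hP0 : 0 < P := hs.trans hP
  have ha0 : 0 < a := by
    rcases ha.eq_or_lt with h | h
    · rw [← h, Real.zero_rpow (by positivity)] at h2
      linarith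
    · exact h
  obtain ⟨b, hb⟩ : ∃ b, b = a ^ (1/s) := ⟨_, rfl⟩
  rw [← hb] at h2
  have hb0 : 0 < b := by rw [hb]; positivity
  have hab : a = b ^ s := by
    rw [hb, ← Real.rpow_mul ha]; field_simp; simp
  have h3 : b ^ P * r ^ d ≤ M := by
    have h4 : (b ^ s) ^ (P/s) ≤ ((M / r^d) ^ (s/P)) ^ (P/s) := by
      rw [← hab]; gcongr
    rw [←  Real.rpow_mul hb0.le, ← Real.rpow_mul (x := M / r^d) (by positivity),
      show s * (P/s) = P by field_simp, show s/P * (P/s) = 1 by field_simp, Real.rpow_one,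
      le_div_iff₀ (by positivity)] at h4
    exact h4
  have h5 : l ^ d < M * b ^ (d - P) := by
    calc l ^ d < (r * b) ^ d := Real.rpow_lt_rpow hl.le h2 (by linarith)
      _ = (b ^ P * r ^ d) * b ^ (d - P) := by
        rw [Real.mul_rpow hr.le hb0.le, Real.rpow_sub hb0]
        have : 0 < b ^ P := by positivity
        field_simp
      _ ≤ _ := by gcongr
  have h6 : l ^ d / M < b ^ (d - P) := by
    rw [div_lt_iff₀ hM]; linarith
  have hdP : 0 < d - P := by linarith
  calc (l^d / M) ^ (s/(d-P)) < (b ^ (d - P)) ^ (s/(d-P)) := by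
        apply Real.rpow_lt_rpow (by positivity) h6 (by positivity)
    _ = a := by
        rw [← Real.rpow_mul hb0.le, hab]
        congr 1; field_simp

end

noncomputable section

/-- The measure with density `u`. -/
def gwν {n : ℕ} (u : Pt n → ℝ) : Measure (Pt n) := volume.withDensity (fun z => ENNReal.ofReal (u z))

lemma gw_weak' {n : ℕ} (γ : ℝ) (hγ : 1 < γ) (u : Pt n → ℝ) (hu : ∀ z, 0 ≤ u z) 
    (T : Set (Pt n)) (ρ : Pt n → ℝ) (R : ℝ)
    (h0 : ∀ z ∈ T, 0 < ρ z) (hR : ∀ z ∈ T, ρ z ≤ R) (μ : ℝ) (hμ : 0 < μ) (hum : AEMeasurable u)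
    (ht : ∀ z ∈ T, 2 * μ < tailAvg γ u z.1 z.2 (ρ z)) :
    volume (⋃ z ∈ T, cylinder z.1 z.2 (ρ z ^ 2) (ρ z)) ≤
      ENNReal.ofReal (150 * 5 ^ n / μ) * gwν u {z | μ / 2 < u z} := by
  have h := gw_weak γ hγ u hu T ρ R h0 hR μ hμ hum ht
  have h2 : ENNReal.ofReal (μ⁻¹) * ENNReal.ofReal μ = 1 := by
    rw [← ENNReal.ofReal_mul (by positivity), inv_mul_cancel₀ hμ.ne', ENNReal.ofReal_one]
  calc volume (⋃ z ∈ T, cylinder z.1 z.2 (ρ z ^ 2) (ρ z)) 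
      = ENNReal.ofReal (μ⁻¹) * (ENNReal.ofReal μ * volume (⋃ z ∈ T, cylinder z.1 z.2 (ρ z ^ 2) (ρ z))) := by
        rw [← mul_assoc, h2, one_mul]
    _ ≤ ENNReal.ofReal (μ⁻¹) * (ENNReal.ofReal (150 * 5 ^ n) * gwν u {z | μ / 2 < u z}) := by
        exact mul_le_mul' le_rfl h
    _ = _ := by
        rw [← mul_assoc, ← ENNReal.ofReal_mul (by positivity)]
        congr 2; field_simp

lemma gw_level {n : ℕ} (A₀ γ : ℝ) (hA : 1 ≤ A₀) (hγ : 1 < γ) (s P M : ℝ) (hs : 0 < s) (hP : s < P)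
    (hPd : P < (n:ℝ) + 2) (hM : 0 < M) (g f h : Pt n → ℝ)
    (hg : ∀ z, 0 ≤ g z) (hf : ∀ z, 0 ≤ f z) (hh : ∀ z, 0 ≤ h z)
    (gm : AEMeasurable g) (fm : AEMeasurable f) (hm : AEMeasurable h)
    (gi : Integrable (fun z => g z ^ 2))
    (hMi : ∫⁻ z, ENNReal.ofReal (h z ^ P) ≤ ENNReal.ofReal M)
    (H : ∀ (t₀ : ℝ) (x₀ : Spc n) (r : ℝ), 0 < r →
              (⨍ z in cylinder t₀ x₀ (r^2) r, g z ^ 2) ^ (1/2 : ℝ)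
                ≤ A₀ * tailAvg γ g t₀ x₀ r
                  + (tailAvg γ (fun z => f z ^ 2) t₀ x₀ r) ^ (1/2 : ℝ)
                  + r * (tailAvg γ (fun z => h z ^ s) t₀ x₀ r) ^ (1 / s))
    (l : ℝ) (hl : 0 < l) (μ : ℝ) (hμ : μ = ((l/3)^((n:ℝ)+2) / M) ^ (s/((n:ℝ)+2-P)) / 2) :
    gwν (fun z => g z ^ 2) {z | l < g z} ≤
      ENNReal.ofReal (25 * 5^n * (150 * 5^n) * (6 * A₀) * l) * gwν g {z | l < 12 * A₀ * g z}
      + ENNReal.ofReal (25 * 5^n * (150 * 5^n) * 18) * gwν (fun z => f z ^ 2) {z | l < 6 * f z}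
      + ENNReal.ofReal (25 * 5^n * (150 * 5^n) * (l^2 / μ)) * 
        gwν (fun z => h z ^ s) {z | μ / 2 < h z ^ s} := by
  have hA0 : 0 < A₀ := by linarith
  have hμ0 : 0 < μ := by rw [hμ]; positivity
  obtain ⟨U, ρ, R, h0, hR, hav, hU⟩ := gw_cz (fun z => g z ^ 2) (fun z => by positivity) gi (l^2) (by positivity)
  have e1 : {z | l^2 < g z ^ 2} = {z | l < g z} := by
    ext z; exact sq_lt_sq₀ hl.le (hg z)
  have e2 : {z | (l/(6*A₀)) / 2 < g z} = {z | l < 12 * A₀ * g z} := by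
    ext z
    simp only [mem_ofPred_eq]
    rw [div_div, div_lt_iff₀ (by positivity)]
    ring_nf
  have e3 : {z | (l^2/18) / 2 < f z ^ 2} = {z | l < 6 * f z} := by
    ext z
    simp only [mem_ofPred_eq]
    rw [← sq_lt_sq₀ hl.le (by have := hf z; positivity), div_div, div_lt_iff₀ (by positivity)]
    ring_nf
  rw [e1] at hU
  let Ua := {z ∈ U | 2 * (l/(6*A₀)) < tailAvg γ g z.1 z.2 (ρ z)}
  let Ub := {z ∈ U | 2 * (l^2/18) < tailAvg γ (fun z => f z ^ 2) z.1 z.2 (ρ z)}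
  let Uc := {z ∈ U | 2 * μ < tailAvg γ (fun z => h z ^ s) z.1 z.2 (ρ z)}
  have hcov : ∀ z ∈ U, z ∈ Ua ∨ z ∈ Ub ∨ z ∈ Uc := by
    intro z hz
    by_contra! hcon
    obtain ⟨ca, cb, cc⟩ := hcon
    have ca' : tailAvg γ g z.1 z.2 (ρ z) ≤ 2 * (l/(6*A₀)) := not_lt.1 fun hlt => ca ⟨hz, hlt⟩
    have cb' : tailAvg γ (fun z => f z ^ 2) z.1 z.2 (ρ z) ≤ 2 * (l^2/18) := not_lt.1 fun hlt => cb ⟨hz, hlt⟩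
    have cc' : tailAvg γ (fun z => h z ^ s) z.1 z.2 (ρ z) ≤ 2 * μ := not_lt.1 fun hlt => cc ⟨hz, hlt⟩
    have hz0 := h0 z hz
    have hH := H z.1 z.2 (ρ z) hz0
    have b0 : l < (⨍ w in cylinder z.1 z.2 (ρ z^2) (ρ z), g w ^ 2) ^ (1/2 : ℝ) := by
      rw [← Real.sqrt_eq_rpow]
      exact Real.lt_sqrt_of_sq_lt (hav z hz)
    have b1 : A₀ * tailAvg γ g z.1 z.2 (ρ z) ≤ l / 3 := by
      calc _ ≤ A₀ * (2 * (l/(6*A₀))) := by gcongr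
        _ = l/3 := by field_simp; norm_num
    have b2 : (tailAvg γ (fun z => f z ^ 2) z.1 z.2 (ρ z)) ^ (1/2:ℝ) ≤ l / 3 := by
      rw [← Real.sqrt_eq_rpow, Real.sqrt_le_left (by positivity)]
      linarith
    have b3 : l/3 < ρ z * (tailAvg γ (fun z => h z ^ s) z.1 z.2 (ρ z)) ^ (1/s) := by linarith
    have b4 := gw_hedberg ((n:ℝ)+2) s P M (ρ z) _ (l/3) hs hP hPd hM hz0 (by positivity)
      (gw_tail_nonneg γ _ (fun z => Real.rpow_nonneg (hh z) _) _ _ _)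
      (gw_tail_hold γ hγ h hh hm s P hs hP M hM hMi z.1 z.2 (ρ z) hz0) b3
    rw [hμ] at cc'
    linarith
  have hsub : (⋃ z ∈ U, cylinder z.1 z.2 (ρ z ^ 2) (ρ z)) ⊆
      ((⋃ z ∈ Ua, cylinder z.1 z.2 (ρ z ^ 2) (ρ z)) ∪ (⋃ z ∈ Ub, cylinder z.1 z.2 (ρ z ^ 2) (ρ z)))
      ∪ (⋃ z ∈ Uc, cylinder z.1 z.2 (ρ z ^ 2) (ρ z)) := by
    refine iUnion₂_subset fun z hz w hw => ?_
    rcases hcov z hz with h | h | h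
    · exact Or.inl (Or.inl (mem_biUnion h hw))
    · exact Or.inl (Or.inr (mem_biUnion h hw))
    · exact Or.inr (mem_biUnion h hw)
  have wa := gw_weak' γ hγ g hg Ua ρ R (fun z hz => h0 z hz.1) (fun z hz => hR z hz.1)
    (l/(6*A₀)) (by positivity) gm (fun z hz => hz.2)
  have wb := gw_weak' γ hγ (fun z => f z ^ 2) (fun z => by positivity) Ub ρ R (fun z hz => h0 z hz.1) (fun z hz => hR z hz.1)
    (l^2/18) (by positivity) (fm.pow_const 2) (fun z hz => hz.2)
  have wc := gw_weak' γ hγ (fun z => h z ^ s) (fun z => Real.rpow_nonneg (hh z) _) Uc ρ R (fun z hz => h0 z hz.1) (fun z hz => hR z hz.1)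
    μ hμ0 (hm.pow_const s) (fun z hz => hz.2)
  rw [e2] at wa
  rw [e3] at wb
  refine hU.trans ?_
  calc _ ≤ ENNReal.ofReal (25 * 5^n * l^2) * 
        (ENNReal.ofReal (150 * 5 ^ n / (l/(6*A₀))) * gwν g {z | l < 12 * A₀ * g z} + 
        ENNReal.ofReal (150 * 5 ^ n / (l^2/18)) * gwν (fun z => f z ^ 2) {z | l < 6 * f z} + 
        ENNReal.ofReal (150 * 5 ^ n / μ) * gwν (fun z => h z ^ s) {z | μ / 2 < h z ^ s}) := by
        gcongr
        refine (measure_mono hsub).trans ((measure_union_le _ _).trans ?_)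
        exact add_le_add ((measure_union_le _ _).trans (add_le_add wa wb)) wc
    _ = _ := by
        rw [mul_add, mul_add, ← mul_assoc, ← mul_assoc, ← mul_assoc,
          ← ENNReal.ofReal_mul (by positivity), ← ENNReal.ofReal_mul (by positivity),
          ← ENNReal.ofReal_mul (by positivity)]
        have x1 : 25 * 5^n * l^2 * (150 * 5^n / (l/(6*A₀))) = 25 * 5^n * (150 * 5^n) * (6 * A₀) * l := by
          field_simp
        have x2 : 25 * 5^n * l^2 * (150 * 5^n / (l^2/18)) = 25 * 5^n * (150 * 5^n) * 18 := by
          field_simp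
        have x3 : 25 * 5^n * l^2 * (150 * 5^n / μ) = 25 * 5^n * (150 * 5^n) * (l^2 / μ) := by
          field_simp
        rw [x1, x2, x3]

/-- Layer cake with weight. -/
lemma gw_layer {n : ℕ} (w v : Pt n → ℝ) (hw : ∀ z, 0 ≤ w z) (hwm : AEMeasurable w) (hv : ∀ z, 0 ≤ v z) (hvm : AEMeasurable v)
    (a : ℝ) (ha : 0 < a) :
    ∫⁻ z, ENNReal.ofReal (w z * v z ^ a) =
      ENNReal.ofReal a * ∫⁻ t in Ioi 0, gwν w {z | t < v z} * ENNReal.ofReal (t ^ (a - 1)) := by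
  have hac : gwν w ≪ volume := withDensity_absolutelyContinuous _ _
  rw [← lintegral_rpow_eq_lintegral_meas_lt_mul (gwν w) (ae_of_all _ hv) (hvm.mono_ac hac) ha, gwν,
    lintegral_withDensity_eq_lintegral_mul₀ hwm.ennreal_ofReal (hvm.pow_const a).ennreal_ofReal]
  refine lintegral_congr fun z => ?_
  rw [Pi.mul_apply, ENNReal.ofReal_mul (hw z)]

end

noncomputable section

lemma gw_meas_level {n : ℕ} (w v : Pt n → ℝ) : Measurable (fun t : ℝ => gwν w {z | t < v z}) := by
  apply Antitone.measurable
  intro a b hab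
  exact measure_mono fun z (hz : b < v z) => lt_of_le_of_lt hab hz

/-- first term -/
lemma gw_I1 {n : ℕ} (A N p : ℝ) (hA : 1 ≤ A) (hN : 0 < N) (hp : 2 < p) (hp3 : p ≤ 3) (g : Pt n → ℝ)
    (hg : ∀ z, 0 ≤ g z) (gm : AEMeasurable g) :
    ∫⁻ t in Ioi 0, gwν g {z | t < min (A * g z) N} * ENNReal.ofReal (t ^ (p - 1 - 1)) ≤
      ENNReal.ofReal (A ^ 2) * ∫⁻ z, ENNReal.ofReal (g z ^ 2 * min (g z) N ^ (p - 2)) := by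
  have hA0 : 0 < A := by linarith
  have h1 := gw_layer g (fun z => min (A * g z) N) hg gm
    (fun z => le_min (mul_nonneg hA0.le (hg z)) hN.le) ((gm.const_mul A).min aemeasurable_const) (p-1) (by linarith)
  have h2 : (∫⁻ t in Ioi 0, gwν g {z | t < min (A * g z) N} * ENNReal.ofReal (t ^ (p - 1 - 1))) ≤
      ∫⁻ z, ENNReal.ofReal (g z * min (A * g z) N ^ (p-1)) := by
    rw [h1]
    exact le_mul_of_one_le_left' (by rw [ENNReal.one_le_ofReal]; linarith)
  refine h2.trans ?_
  rw [← lintegral_const_mul' _ _ ENNReal.ofReal_ne_top]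
  refine lintegral_mono fun z => ?_
  rw [← ENNReal.ofReal_mul (by positivity)]
  apply ENNReal.ofReal_le_ofReal
  have hm0 : 0 ≤ min (g z) N := le_min (hg z) hN.le
  have hm1 : min (A * g z) N ≤ A * min (g z) N := by
    rw [mul_min_of_nonneg _ _ hA0.le]
    exact min_le_min le_rfl (by nlinarith)
  have hm2 : 0 ≤ min (A * g z) N := le_min (mul_nonneg hA0.le (hg z)) hN.le
  have hz := hg z
  calc g z * min (A * g z) N ^ (p-1) ≤ g z * (A * min (g z) N) ^ (p-1) := by
        gcongr
        linarith
    _ = A ^ (p-1) * (g z * (min (g z) N ^ ((p-2) + 1))) := by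
        rw [Real.mul_rpow hA0.le hm0, show p - 1 = (p-2)+1 by ring]; ring
    _ = A ^ (p-1) * (g z * (min (g z) N ^ (p-2) * min (g z) N)) := by
        rw [Real.rpow_add_one' hm0 (by linarith)]
    _ ≤ A ^ (2:ℝ) * (g z * (min (g z) N ^ (p-2) * g z)) := by
        have : A ^ (p-1) ≤ A ^ (2:ℝ) := Real.rpow_le_rpow_of_exponent_le hA (by linarith)
        have h3 : 0 ≤ min (g z) N ^ (p-2) := Real.rpow_nonneg hm0 _
        gcongr
        exact min_le_left _ _
    _ = _ := by rw [Real.rpow_two]; ring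

/-- second term -/
lemma gw_I2 {n : ℕ} (p : ℝ) (hp : 2 < p) (hp3 : p ≤ 3) (f : Pt n → ℝ)
    (hf : ∀ z, 0 ≤ f z) (fm : AEMeasurable f) :
    ENNReal.ofReal (p-2) * ∫⁻ t in Ioi 0, gwν (fun z => f z ^ 2) {z | t < 6 * f z} * ENNReal.ofReal (t ^ (p - 2 - 1)) ≤
      ENNReal.ofReal 6 * ∫⁻ z, ENNReal.ofReal (f z ^ p) := by
  rw [← gw_layer (fun z => f z ^ 2) (fun z => 6 * f z) (fun z => by positivity) (fm.pow_const 2)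
    (fun z => mul_nonneg (by norm_num) (hf z)) (fm.const_mul 6) (p-2) (by linarith)]
  rw [← lintegral_const_mul' _ _ ENNReal.ofReal_ne_top]
  refine lintegral_mono fun z => ?_
  rw [← ENNReal.ofReal_mul (by positivity)]
  apply ENNReal.ofReal_le_ofReal
  have hz := hf z
  have h6 : (6:ℝ) ^ (p-2) ≤ 6 := by
    calc (6:ℝ) ^ (p-2) ≤ 6 ^ (1:ℝ) := Real.rpow_le_rpow_of_exponent_le (by norm_num) (by linarith)
      _ = 6 := Real.rpow_one _
  calc f z ^ 2 * (6 * f z) ^ (p-2) = 6 ^ (p-2) * (f z ^ (2:ℝ) * f z ^ (p-2)) := by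
        rw [Real.mul_rpow (by norm_num) hz, Real.rpow_two]; ring
    _ = 6 ^ (p-2) * f z ^ p := by
        rw [← Real.rpow_add' hz (by linarith)]; congr 2; ring
    _ ≤ _ := by gcongr

/-- third term -/
lemma gw_I3 {n : ℕ} (p s P β κ : ℝ) (hs : 0 < s) (hP : 0 < P) (hβ : 0 < β) (hpβ : β < p) (e : s * p = P * β) 
    (hκ : 0 < κ) (h : Pt n → ℝ)
    (hh : ∀ z, 0 ≤ h z) (hm : AEMeasurable h) :
    ∫⁻ t in Ioi 0, gwν (fun z => h z ^ s) {z | t < κ * h z ^ (s/β)} * ENNReal.ofReal (t ^ (p - β - 1)) =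
      ENNReal.ofReal (κ ^ (p - β) / (p - β)) * ∫⁻ z, ENNReal.ofReal (h z ^ P) := by
  have hd : 0 < p - β := by linarith
  have h1 := gw_layer (fun z => h z ^ s) (fun z => κ * h z ^ (s/β)) (fun z => Real.rpow_nonneg (hh z) _) (hm.pow_const s)
    (fun z => mul_nonneg hκ.le (Real.rpow_nonneg (hh z) _)) ((hm.pow_const _).const_mul κ) (p-β) (by linarith)
  have h2 : ∀ z, ENNReal.ofReal (h z ^ s * (κ * h z ^ (s/β)) ^ (p-β)) = 
      ENNReal.ofReal (κ ^ (p-β)) * ENNReal.ofReal (h z ^ P) := by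
    intro z
    have hz := hh z
    rw [← ENNReal.ofReal_mul (by positivity)]
    congr 1
    have ee : s + s / β * (p - β) = P := by field_simp; linarith
    rw [Real.mul_rpow hκ.le (by positivity), ← Real.rpow_mul hz, ← mul_assoc, mul_comm (h z ^ s), mul_assoc,
      ← Real.rpow_add' hz (by rw [ee]; exact hP.ne'), ee]
  simp_rw [h2] at h1
  rw [lintegral_const_mul' _ _ ENNReal.ofReal_ne_top] at h1
  have h3 : ENNReal.ofReal (p-β)⁻¹ * ENNReal.ofReal (p-β) = 1 := by
    rw [← ENNReal.ofReal_mul (by positivity), inv_mul_cancel₀ hd.ne', ENNReal.ofReal_one]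
  rw [div_eq_inv_mul (κ ^ (p - β)), ENNReal.ofReal_mul (by positivity), mul_assoc, h1, ← mul_assoc, h3, one_mul]

lemma gw_mu (d s P M p β l y : ℝ) (hd : 0 < d) (hs : 0 < s) (hP : 0 < P) (hp : 0 < p)
    (hM : 0 < M) (hl : 0 < l) (hy : 0 ≤ y) (e1 : P * (p + d) = p * d) (e2 : s * p = P * β) (hβ : 0 < β) :
    l ^ 2 / (((l/3)^d / M) ^ (s/(d-P)) / 2) * l ^ (p - 3) = 2 * 3 ^ β * M ^ (β/d) * l ^ (p - β - 1) ∧ 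
    (((((l/3)^d / M) ^ (s/(d-P)) / 2) / 2 < y ^ s) ↔ l < 3 * (4 ^ (1/β) * M ^ (1/d)) * y ^ (s/β)) := by
  have hdP : 0 < d - P := by nlinarith [mul_pos hP hd]
  have hx : s / (d-P) = β / d := by
    rw [div_eq_div_iff hdP.ne' hd.ne']
    have : p * (s * d) = p * (β * (d - P)) := by
      have : p * (s * d) = P * β * d := by rw [← e2]; ring
      rw [this]; linear_combination β * e1
    exact mul_left_cancel₀ hp.ne' this
  have hmu : ((l/3)^d / M) ^ (s/(d-P)) = l ^ β / (3 ^ β * M ^ (β/d)) := by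
    rw [hx, Real.div_rpow (by positivity) hM.le, ← Real.rpow_mul (by positivity), 
      show d * (β / d) = β by field_simp, Real.div_rpow hl.le (by norm_num), div_div]
  rw [hmu]
  constructor
  · have h1 : l ^ (p - β - 1) * l ^ β = l ^ 2 * l ^ (p-3) := by
      rw [← Real.rpow_add hl, ← Real.rpow_two, ← Real.rpow_add hl]; congr 1; ring
    have : 0 < l ^ β := by positivity
    field_simp
    linear_combination -h1
  · have hw : 0 ≤ 3 * (4 ^ (1/β) * M ^ (1/d)) * y ^ (s/β) := by positivity
    rw [← Real.rpow_lt_rpow_iff hl.le hw hβ]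
    rw [Real.mul_rpow (by positivity) (by positivity), Real.mul_rpow (by positivity) (by positivity),
      Real.mul_rpow (by positivity) (by positivity), ← Real.rpow_mul hy, ← Real.rpow_mul (by norm_num), ← Real.rpow_mul hM.le,
      show s / β * β = s by field_simp, show 1 / β * β = 1 by field_simp, show 1 / d * β = β / d by field_simp, Real.rpow_one]
    rw [div_div, div_div, div_lt_iff₀ (by positivity)]
    constructor <;> intro h <;> linarith

end

noncomputable section

lemma gw_int {n : ℕ} (A₀ γ : ℝ) (hA : 1 ≤ A₀) (hγ : 1 < γ) (s P p β M N : ℝ) (hs : 0 < s) (hP : s < P)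
    (hPd : P < (n:ℝ) + 2) (hp : 2 < p) (hp3 : p ≤ 3) 
    (e1 : P * (p + ((n:ℝ)+2)) = p * ((n:ℝ)+2)) (e2 : s * p = P * β)
    (hM : 0 < M) (hN : 0 < N) (g f h : Pt n → ℝ)
    (hg : ∀ z, 0 ≤ g z) (hf : ∀ z, 0 ≤ f z) (hh : ∀ z, 0 ≤ h z)
    (gm : AEMeasurable g) (fm : AEMeasurable f) (hm : AEMeasurable h)
    (gi : Integrable (fun z => g z ^ 2))
    (hMi : ∫⁻ z, ENNReal.ofReal (h z ^ P) ≤ ENNReal.ofReal M)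
    (H : ∀ (t₀ : ℝ) (x₀ : Spc n) (r : ℝ), 0 < r →
              (⨍ z in cylinder t₀ x₀ (r^2) r, g z ^ 2) ^ (1/2 : ℝ)
                ≤ A₀ * tailAvg γ g t₀ x₀ r
                  + (tailAvg γ (fun z => f z ^ 2) t₀ x₀ r) ^ (1/2 : ℝ)
                  + r * (tailAvg γ (fun z => h z ^ s) t₀ x₀ r) ^ (1 / s))
    (K : ℝ) (hK : K = 25 * 5^n * (150 * 5^n)) :
    ∫⁻ z, ENNReal.ofReal (g z ^ 2 * min (g z) N ^ (p - 2)) ≤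
      ENNReal.ofReal ((p-2) * (K * (6*A₀) * (12*A₀)^2)) * (∫⁻ z, ENNReal.ofReal (g z ^ 2 * min (g z) N ^ (p - 2)))
      + ENNReal.ofReal (K * 18 * 6) * (∫⁻ z, ENNReal.ofReal (f z ^ p))
      + ENNReal.ofReal ((p-2) * K * (2 * 3 ^ β) * ((3 * 4 ^ (1/β)) ^ (p-β) / (p-β)) * M ^ (p/P)) := by
  have hA0 : 0 < A₀ := by linarith
  have hP0 : 0 < P := by linarith
  have hβ : 0 < β := by
    have : 0 < P * β := by rw [← e2]; positivity
    exact (pos_iff_pos_of_mul_pos this).1 hP0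
  have hβp : β < p := by
    by_contra! hc
    have : P * p ≤ P * β := by gcongr
    nlinarith
  have hpβ : 0 < p - β := by linarith
  have hd : 0 < (n:ℝ) + 2 := by positivity
  have hK0 : 0 < K := by rw [hK]; positivity
  have hp2 : 0 < p - 2 := by linarith
  set κ := 3 * (4 ^ (1/β) * M ^ (1/((n:ℝ)+2))) with hκ
  have hκ0 : 0 < κ := by positivity
  have hpt : ∀ l ∈ Ioi (0:ℝ), gwν (fun z => g z ^ 2) {z | l < min (g z) N} * ENNReal.ofReal (l ^ (p - 2 - 1)) ≤
      (ENNReal.ofReal (K * (6 * A₀)) * (gwν g {z | l < min (12 * A₀ * g z) N} * ENNReal.ofReal (l ^ (p - 1 - 1)))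
      + ENNReal.ofReal (K * 18) * (gwν (fun z => f z ^ 2) {z | l < 6 * f z} * ENNReal.ofReal (l ^ (p - 2 - 1))))
      + ENNReal.ofReal (K * (2 * 3 ^ β * M ^ (β/((n:ℝ)+2)))) * 
        (gwν (fun z => h z ^ s) {z | l < κ * h z ^ (s/β)} * ENNReal.ofReal (l ^ (p - β - 1))) := by
    intro l hl
    have hl : 0 < l := hl
    rcases lt_or_ge l N with hlN | hlN
    · have a1 : {z | l < min (g z) N} = {z | l < g z} := by ext z; simp [hlN]
      have a2 : {z | l < min (12 * A₀ * g z) N} = {z | l < 12 * A₀ * g z} := by ext z; simp [hlN]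
      rw [a1, a2]
      have hlev := gw_level A₀ γ hA hγ s P M hs hP hPd hM g f h hg hf hh gm fm hm gi hMi H l hl _ rfl
      have a3 : {z | ((l/3)^((n:ℝ)+2) / M) ^ (s/((n:ℝ)+2-P)) / 2 / 2 < h z ^ s} = {z | l < κ * h z ^ (s/β)} := by
        ext z
        exact (gw_mu ((n:ℝ)+2) s P M p β l (h z) hd hs hP0 (by linarith) hM hl (hh z) e1 e2 hβ).2
      have a4 := (gw_mu ((n:ℝ)+2) s P M p β l 0 hd hs hP0 (by linarith) hM hl le_rfl e1 e2 hβ).1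
      rw [a3, ← hK] at hlev
      set μ := ((l/3)^((n:ℝ)+2) / M) ^ (s/((n:ℝ)+2-P)) / 2 with hμ
      have hμ0 : 0 < μ := by positivity
      have b1 : l * l ^ (p-2-1) = l ^ (p - 1 - 1) := by
        rw [← Real.rpow_one_add' hl.le (by linarith)]; congr 1; ring
      have b3 : l^2/μ * l ^ (p-2-1) = 2 * 3 ^ β * M ^ (β/((n:ℝ)+2)) * l ^ (p - β - 1) := by
        rw [← a4]; congr 2; ring
      calc _ ≤ _ := mul_le_mul' hlev le_rfl
        _ = _ := by
          rw [add_mul, add_mul]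
          congr 1
          · congr 1
            · rw [← b1, ENNReal.ofReal_mul hl.le, ENNReal.ofReal_mul (q := l) (by positivity)]; ring
            · ring
          · rw [ENNReal.ofReal_mul hK0.le, ENNReal.ofReal_mul hK0.le, mul_right_comm, mul_assoc (ENNReal.ofReal K),
              ← ENNReal.ofReal_mul (by positivity), b3, ENNReal.ofReal_mul (by positivity)]
            ring
    · have a1 : {z | l < min (g z) N} = ∅ := by
        ext z; simp [not_lt.2 hlN]
      rw [a1]; simp
  have hintg := setLIntegral_mono' (μ := volume) measurableSet_Ioi hpt
  have m1 : ∀ a : ℝ, Measurable (fun l : ℝ => ENNReal.ofReal (l ^ a)) := fun a => by fun_prop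
  rw [lintegral_add_left (by
      exact (((gw_meas_level _ _).mul (m1 _)).const_mul _).add (((gw_meas_level _ _).mul (m1 _)).const_mul _)),
    lintegral_add_left (by
      exact (((gw_meas_level _ _).mul (m1 _)).const_mul _)),
    lintegral_const_mul' _ _ ENNReal.ofReal_ne_top, lintegral_const_mul' _ _ ENNReal.ofReal_ne_top,
    lintegral_const_mul' _ _ ENNReal.ofReal_ne_top] at hintg
  have i1 := gw_I1 (12*A₀) N p (by linarith) hN hp hp3 g hg gm
  have i2 := gw_I2 p hp hp3 f hf fm
  have i3 := gw_I3 p s P β κ hs hP0 hβ hβp e2 hκ0 h hh hm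
  have hlay := gw_layer (fun z => g z ^ 2) (fun z => min (g z) N) (fun z => by positivity) (gm.pow_const 2)
    (fun z => le_min (hg z) hN.le) (gm.min aemeasurable_const) (p-2) hp2
  set X := ∫⁻ z, ENNReal.ofReal (g z ^ 2 * min (g z) N ^ (p - 2)) with hX
  rw [i3] at hintg
  calc X = _ := hlay
    _ ≤ _ := mul_le_mul' le_rfl hintg
    _ ≤ _ := by
      rw [mul_add, mul_add]
      refine add_le_add (add_le_add ?_ ?_) ?_
      · calc _ ≤ _ := mul_le_mul' le_rfl (mul_le_mul' le_rfl i1)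
          _ = _ := by
            rw [← mul_assoc, ← mul_assoc, ← ENNReal.ofReal_mul hp2.le, ← ENNReal.ofReal_mul (by positivity)]
            ring_nf
      · rw [mul_left_comm]
        calc _ ≤ _ := mul_le_mul' le_rfl i2
          _ = _ := by
            rw [← mul_assoc, ← ENNReal.ofReal_mul (by positivity)]
      · calc _ ≤ ENNReal.ofReal (p-2) * (ENNReal.ofReal (K * (2 * 3 ^ β * M ^ (β/((n:ℝ)+2)))) * 
              (ENNReal.ofReal (κ ^ (p - β) / (p - β)) * ENNReal.ofReal M)) := by
              gcongr
          _ = _ := by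
            rw [← ENNReal.ofReal_mul (by positivity), ← ENNReal.ofReal_mul (by positivity), ← ENNReal.ofReal_mul (by positivity)]
            congr 1
            have k1 : κ ^ (p-β) = (3 * 4 ^ (1/β)) ^ (p-β) * M ^ ((p-β)/((n:ℝ)+2)) := by
              rw [hκ, ← mul_assoc, Real.mul_rpow (by positivity) (by positivity), ← Real.rpow_mul hM.le]
              congr 2; ring
            have k2 : M ^ (p/P) = M ^ (β/((n:ℝ)+2)) * M ^ ((p-β)/((n:ℝ)+2)) * M := by
              rw [← Real.rpow_add hM, ← Real.rpow_add_one hM.ne']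
              congr 1
              field_simp
              linear_combination -e1
            rw [k1, k2]; ring

lemma gw_lim {n : ℕ} (A₀ γ : ℝ) (hA : 1 ≤ A₀) (hγ : 1 < γ) (s P p β M : ℝ) (hs : 0 < s) (hP : s < P)
    (hPd : P < (n:ℝ) + 2) (hp : 2 < p) (hp3 : p ≤ 3) 
    (e1 : P * (p + ((n:ℝ)+2)) = p * ((n:ℝ)+2)) (e2 : s * p = P * β)
    (hM : 0 < M) (g f h : Pt n → ℝ)
    (hg : ∀ z, 0 ≤ g z) (hf : ∀ z, 0 ≤ f z) (hh : ∀ z, 0 ≤ h z)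
    (gm : AEMeasurable g) (fm : AEMeasurable f) (hm : AEMeasurable h)
    (gi : Integrable (fun z => g z ^ 2))
    (hMi : ∫⁻ z, ENNReal.ofReal (h z ^ P) ≤ ENNReal.ofReal M)
    (H : ∀ (t₀ : ℝ) (x₀ : Spc n) (r : ℝ), 0 < r →
              (⨍ z in cylinder t₀ x₀ (r^2) r, g z ^ 2) ^ (1/2 : ℝ)
                ≤ A₀ * tailAvg γ g t₀ x₀ r
                  + (tailAvg γ (fun z => f z ^ 2) t₀ x₀ r) ^ (1/2 : ℝ)
                  + r * (tailAvg γ (fun z => h z ^ s) t₀ x₀ r) ^ (1 / s))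
    (K D : ℝ) (hK : K = 25 * 5^n * (150 * 5^n)) 
    (hD1 : 2 * (K * 18 * 6) ≤ D) 
    (hD2 : 2 * ((p-2) * K * (2 * 3 ^ β) * ((3 * 4 ^ (1/β)) ^ (p-β) / (p-β))) ≤ D)
    (hsm : (p-2) * (K * (6*A₀) * (12*A₀)^2) ≤ 1/2) :
    ∫⁻ z, ENNReal.ofReal (g z ^ p) ≤ ENNReal.ofReal D * ((∫⁻ z, ENNReal.ofReal (f z ^ p)) + ENNReal.ofReal (M ^ (p/P))) := by
  have hp2 : 0 < p - 2 := by linarith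
  set F := ∫⁻ z, ENNReal.ofReal (f z ^ p) with hF
  have hN : ∀ N : ℕ, ∫⁻ z, ENNReal.ofReal (g z ^ 2 * min (g z) ((N:ℝ)+1) ^ (p - 2)) ≤ 
      ENNReal.ofReal D * (F + ENNReal.ofReal (M ^ (p/P))) := by
    intro N
    have hN0 : 0 < (N:ℝ) + 1 := by positivity
    have h1 := gw_int A₀ γ hA hγ s P p β M ((N:ℝ)+1) hs hP hPd hp hp3 e1 e2 hM hN0 g f h hg hf hh gm fm hm gi hMi H K hK
    set X := ∫⁻ z, ENNReal.ofReal (g z ^ 2 * min (g z) ((N:ℝ)+1) ^ (p - 2)) with hX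
    have hXf : X ≠ ⊤ := by
      have : X ≤ ENNReal.ofReal (((N:ℝ)+1)^(p-2)) * ∫⁻ z, ENNReal.ofReal (g z ^ 2) := by
        rw [← lintegral_const_mul' _ _ ENNReal.ofReal_ne_top]
        refine lintegral_mono fun z => ?_
        rw [← ENNReal.ofReal_mul (by positivity), mul_comm (g z ^ 2)]
        apply ENNReal.ofReal_le_ofReal
        have : 0 ≤ min (g z) ((N:ℝ)+1) := le_min (hg z) hN0.le
        gcongr
        exact min_le_right _ _
      refine (this.trans_lt (ENNReal.mul_lt_top ENNReal.ofReal_lt_top ?_)).ne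
      exact gi.lintegral_lt_top
    have h2 : X ≤ ENNReal.ofReal (1/2) * X + ENNReal.ofReal (D/2) * (F + ENNReal.ofReal (M ^ (p/P))) := by
      refine h1.trans ?_
      rw [add_assoc, mul_add]
      refine add_le_add ?_ (add_le_add ?_ ?_)
      · gcongr
      · gcongr; linarith
      · rw [ENNReal.ofReal_mul' (by positivity)]
        gcongr; linarith
    have h3 : X = ENNReal.ofReal (1/2) * X + ENNReal.ofReal (1/2) * X := by
      rw [← add_mul, ← ENNReal.ofReal_add (by norm_num) (by norm_num)]; norm_num
    have h4 : ENNReal.ofReal (1/2) * X ≤ ENNReal.ofReal (D/2) * (F + ENNReal.ofReal (M ^ (p/P))) := by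
      have : ENNReal.ofReal (1/2) * X ≠ ⊤ := ENNReal.mul_ne_top ENNReal.ofReal_ne_top hXf
      rw [← ENNReal.add_le_add_iff_left this, ← h3]
      exact h2
    calc X = ENNReal.ofReal 2 * (ENNReal.ofReal (1/2) * X) := by
          rw [← mul_assoc, ← ENNReal.ofReal_mul (by norm_num)]; norm_num
      _ ≤ ENNReal.ofReal 2 * (ENNReal.ofReal (D/2) * (F + ENNReal.ofReal (M ^ (p/P)))) := by gcongr
      _ = _ := by rw [← mul_assoc, ← ENNReal.ofReal_mul (by norm_num)]; congr 2; ring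
  have hlim : ∫⁻ z, ENNReal.ofReal (g z ^ p) ≤ 
      ⨆ N : ℕ, ∫⁻ z, ENNReal.ofReal (g z ^ 2 * min (g z) ((N:ℝ)+1) ^ (p - 2)) := by
    rw [← lintegral_iSup']
    · refine lintegral_mono fun z => ?_
      obtain ⟨N, hN⟩ := exists_nat_ge (g z)
      refine le_iSup_of_le N ?_
      apply ENNReal.ofReal_le_ofReal
      rw [min_eq_left (by linarith), ← Real.rpow_two, ← Real.rpow_add' (hg z) (by linarith)]
      apply le_of_eq; congr 1; ring
    · intro N
      exact ((gm.pow_const 2).mul ((gm.min aemeasurable_const).pow_const _)).ennreal_ofReal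
    · refine ae_of_all _ fun z => ?_
      intro a b hab
      apply ENNReal.ofReal_le_ofReal
      have : 0 ≤ min (g z) ((a:ℝ)+1) := le_min (hg z) (by positivity)
      have hab' : (a:ℝ) ≤ b := by exact_mod_cast hab
      gcongr
  exact hlim.trans (iSup_le hN)

end

noncomputable section

lemma gw_pnorm {n : ℕ} (g : Pt n → ℝ) (hg : ∀ z, 0 ≤ g z) (p : ℝ) (hp : 0 < p) :
    pnormE g p ^ p = ∫⁻ z, ENNReal.ofReal (g z ^ p) := by
  rw [pnormE, eLpNorm_eq_lintegral_rpow_enorm_toReal (by simpa using hp) ENNReal.ofReal_ne_top,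
    ENNReal.toReal_ofReal hp.le, ← ENNReal.rpow_mul, one_div, inv_mul_cancel₀ hp.ne', ENNReal.rpow_one]
  refine lintegral_congr fun z => ?_
  rw [Real.enorm_of_nonneg (hg z), ENNReal.ofReal_rpow_of_nonneg (hg z) hp.le]

lemma gw_final {G F Hh : ℝ≥0∞} (D q : ℝ) (hq : 0 < q)
    (hb : ∀ M : ℝ, 0 < M → Hh ≤ ENNReal.ofReal M → G ≤ ENNReal.ofReal D * (F + ENNReal.ofReal (M ^ q))) (hD : 0 < D) :
    G ≤ ENNReal.ofReal D * (F + Hh ^ q) := by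
  rcases eq_or_ne Hh ⊤ with hH | hH
  · rw [hH, ENNReal.top_rpow_of_pos hq, add_top, ENNReal.mul_top (by simpa using hD)]
    exact le_top
  have hm : 0 ≤ Hh.toReal := ENNReal.toReal_nonneg
  have hc : Tendsto (fun δ : ℝ => ENNReal.ofReal D * (F + ENNReal.ofReal ((Hh.toReal + δ) ^ q))) (𝓝[>] 0)
      (𝓝 (ENNReal.ofReal D * (F + ENNReal.ofReal ((Hh.toReal + 0) ^ q)))) := by
    refine ENNReal.Tendsto.const_mul ?_ (Or.inr ENNReal.ofReal_ne_top)
    refine Tendsto.add tendsto_const_nhds ?_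
    refine (ENNReal.continuous_ofReal.tendsto _).comp ?_
    have : Continuous (fun δ : ℝ => (Hh.toReal + δ) ^ q) :=
      (continuous_const.add continuous_id).rpow_const (fun _ => Or.inr hq.le)
    exact (this.tendsto 0).mono_left nhdsWithin_le_nhds
  have hr := ge_of_tendsto hc (by
    filter_upwards [self_mem_nhdsWithin] with δ hδ
    have hδ : 0 < δ := hδ
    refine hb _ (by linarith) ?_
    rw [ENNReal.le_ofReal_iff_toReal_le hH (by linarith)]
    linarith)
  rwa [add_zero, ← ENNReal.ofReal_rpow_of_nonneg hm hq.le, ENNReal.ofReal_toReal hH] at hr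

theorem gehring_with_tail_parabolic_exponents
    (n : ℕ) (hn : 0 < n) (A₀ : ℝ) (hA : 1 ≤ A₀) (γ : ℝ) (hγ : 1 < γ) :
    ∃ ε : ℝ, 0 < ε ∧
      ∀ p : ℝ, 2 < p → p < 2 + ε →
        ∃ C : ℝ, 0 < C ∧
          ∀ g f h : Pt n → ℝ,
            (∀ z, 0 ≤ g z) → (∀ z, 0 ≤ f z) → (∀ z, 0 ≤ h z) →
            Integrable (fun z => g z ^ 2) →
            Integrable (fun z => f z ^ 2) →
            Integrable (fun z => h z ^ pLow 2 n) →
            (∀ (t₀ : ℝ) (x₀ : Spc n) (r : ℝ), 0 < r →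
              (⨍ z in cylinder t₀ x₀ (r^2) r, g z ^ 2) ^ (1/2 : ℝ)
                ≤ A₀ * tailAvg γ g t₀ x₀ r
                  + (tailAvg γ (fun z => f z ^ 2) t₀ x₀ r) ^ (1/2 : ℝ)
                  + r * (tailAvg γ (fun z => h z ^ pLow 2 n) t₀ x₀ r) ^ (1 / pLow 2 n)) →
            pnormE g p ≤ ENNReal.ofReal C * (pnormE f p + pnormE h (pLow p n)) := by
  set K : ℝ := 25 * 5^n * (150 * 5^n) with hK
  have hK0 : 0 < K := by positivity
  have hA0 : 0 < A₀ := by linarith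
  set Z : ℝ := K * (6*A₀) * (12*A₀)^2 with hZ
  have hZ0 : 0 < Z := by positivity
  refine ⟨min 1 (1/(2*Z)), by positivity, fun p hp hpε => ?_⟩
  have hp3 : p ≤ 3 := by have := min_le_left 1 (1/(2*Z)); linarith
  have hp0 : 0 < p := by linarith
  have hp2 : 0 < p - 2 := by linarith
  have hsm : (p-2) * Z ≤ 1/2 := by
    have h1 : p - 2 ≤ 1/(2*Z) := by have := min_le_right 1 (1/(2*Z)); linarith
    calc (p-2) * Z ≤ 1/(2*Z) * Z := by gcongr
      _ = 1/2 := by field_simp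
  have hd : 0 < (n:ℝ) + 2 := by positivity
  set s := pLow 2 n with hsdef
  set P := pLow p n with hPdef
  have hs : 0 < s := by rw [hsdef, pLow]; positivity
  have hP0 : 0 < P := by rw [hPdef, pLow]; positivity
  have hP : s < P := by
    rw [hsdef, hPdef, pLow, pLow]
    gcongr
  have hPd : P < (n:ℝ) + 2 := by
    rw [hPdef, pLow]
    apply inv_lt_of_inv_lt₀ hd
    have : 0 < p⁻¹ := by positivity
    linarith
  have e1 : P * (p + ((n:ℝ)+2)) = p * ((n:ℝ)+2) := by
    rw [hPdef, pLow]; field_simp; ring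
  set β := s * p / P with hβ
  have e2 : s * p = P * β := by rw [hβ]; field_simp
  have hβ0 : 0 < β := by positivity
  have hβp : 0 < p - β := by
    have : β < p := by rw [hβ, div_lt_iff₀ hP0]; nlinarith
    linarith
  set D := 2 * (K * 18 * 6) + 2 * ((p-2) * K * (2 * 3 ^ β) * ((3 * 4 ^ (1/β)) ^ (p-β) / (p-β))) with hD
  have t1 : 0 < 2 * (K * 18 * 6) := by positivity
  have t2 : 0 < 2 * ((p-2) * K * (2 * 3 ^ β) * ((3 * 4 ^ (1/β)) ^ (p-β) / (p-β))) := by positivity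
  have hD0 : 0 < D := by linarith
  refine ⟨D ^ (1/p), by positivity, ?_⟩
  intro g f h hg hf hh gi fi hi H
  have gm : AEMeasurable g := by
    have : g = fun z => (g z ^ 2) ^ (1/2:ℝ) := by
      ext z; rw [← Real.sqrt_eq_rpow, Real.sqrt_sq (hg z)]
    rw [this]; exact gi.aemeasurable.pow_const _
  have fm : AEMeasurable f := by
    have : f = fun z => (f z ^ 2) ^ (1/2:ℝ) := by
      ext z; rw [← Real.sqrt_eq_rpow, Real.sqrt_sq (hf z)]
    rw [this]; exact fi.aemeasurable.pow_const _
  have hm : AEMeasurable h := by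
    have : h = fun z => (h z ^ s) ^ (s⁻¹) := by
      ext z; rw [Real.rpow_rpow_inv (hh z) hs.ne']
    rw [this]; exact hi.aemeasurable.pow_const _
  have hmain := gw_final (G := ∫⁻ z, ENNReal.ofReal (g z ^ p)) (F := ∫⁻ z, ENNReal.ofReal (f z ^ p))
    (Hh := ∫⁻ z, ENNReal.ofReal (h z ^ P)) D (p/P) (by positivity) (fun M hM hMi =>
      gw_lim A₀ γ hA hγ s P p β M hs hP hPd hp hp3 e1 e2 hM g f h hg hf hh gm fm hm gi hMi H K D hK
        (by linarith) (by linarith) hsm) hD0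
  rw [← gw_pnorm g hg p hp0, ← gw_pnorm f hf p hp0, ← gw_pnorm h hh P hP0, ← ENNReal.rpow_mul,
    show P * (p / P) = p by field_simp] at hmain
  rw [← ENNReal.rpow_le_rpow_iff hp0]
  refine hmain.trans ?_
  rw [ENNReal.mul_rpow_of_nonneg _ _ hp0.le, ENNReal.ofReal_rpow_of_nonneg (by positivity) hp0.le,
    ← Real.rpow_mul hD0.le, one_div, inv_mul_cancel₀ hp0.ne', Real.rpow_one]
  gcongr
  exact ENNReal.add_rpow_le_rpow_add _ _ (by linarith)

end
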